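/- arXiv:math/0009182 — 2 statements merged into one kernel-verified Lean document; each statement's English description precedes it below -/
import Mathlib

section
/- Let q be a prime power. As n → ∞, the proportion s_A(n,q) of separable elements of the affine group A(n,q) converges to (1 − 1/q)/(1 + 1/(q−1)). -/
open Matrix

/-- Membership in the affine group `A(n,q)`: invertible `(n+1) × (n+1)` matrices with
`x_{11} = 1` and `x_{j1} = 0` for `j ≥ 2` (indices starting at `0` in Lean). -/
def IsAff {F : Type} [Field F] {n : ℕ} (x : GL (Fin (n + 1)) F) : Prop :=
  x.val 0 0 = 1 ∧ ∀ j : Fin (n + 1), j ≠ 0 → x.val j 0 = 0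

/-- `s_A(n,q)`: the proportion of separable elements (squarefree characteristic polynomial)
of the affine group `A(n,q)`. -/
noncomputable def sA (F : Type) [Field F] [Fintype F] (n : ℕ) : ℝ :=
  (Nat.card {x : GL (Fin (n + 1)) F // IsAff x ∧ Squarefree x.val.charpoly} : ℝ) /
    (Nat.card {x : GL (Fin (n + 1)) F // IsAff x} : ℝ)

namespace AffineSeparable

open Polynomial Filter Topology UniqueFactorizationMonoid

section CyclicCount

variable {K V : Type*} [Field K] [AddCommGroup V] [Module K V] [FiniteDimensional K V]

theorem dvd_of_squarefree_of_irreducible_dvd {f m : K[X]} (hf : Squarefree f) (hm : m ≠ 0)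
    (h : ∀ p, Irreducible p → p ∣ f → p ∣ m) : f ∣ m := by
  classical
  obtain ⟨n, hn⟩ := (exists_dvd_pow_iff_radical_dvd (b := m) hf.ne_zero).2
    ((radical_dvd_iff_primeFactors_subset hm).2 fun p hp => by
      rw [mem_primeFactors, mem_normalizedFactors_iff' hf.ne_zero] at hp
      rw [mem_primeFactors, mem_normalizedFactors_iff' hm]
      exact ⟨hp.1, hp.2.1, h p hp.1 hp.2.2⟩)
  exact hf.isRadical n m hn

theorem irreducible_dvd_minpoly_of_dvd_charpoly (φ : Module.End K V) {p : K[X]}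
    (hp : Irreducible p) (h : p ∣ φ.charpoly) : p ∣ minpoly K φ := by
  have := Fact.mk hp
  have hroot : (LinearMap.baseChange (AdjoinRoot p) φ).charpoly.IsRoot (AdjoinRoot.root p) := by
    rw [LinearMap.charpoly_baseChange, IsRoot, eval_map_algebraMap, AdjoinRoot.aeval_eq,
      AdjoinRoot.mk_eq_zero]
    exact h
  rw [← Module.End.hasEigenvalue_iff_isRoot_charpoly] at hroot
  obtain ⟨x, hx⟩ := hroot.exists_hasEigenvector
  have h1 := Module.End.aeval_apply_of_hasEigenvector
    (p := (minpoly K φ).map (algebraMap K (AdjoinRoot p))) hx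
  have h2 : aeval (LinearMap.baseChange (AdjoinRoot p) φ)
      ((minpoly K φ).map (algebraMap K (AdjoinRoot p))) = 0 := by
    rw [aeval_map_algebraMap]
    have := aeval_algHom_apply (Module.End.baseChangeHom K (AdjoinRoot p) V) φ (minpoly K φ)
    rw [minpoly.aeval, map_zero] at this
    exact this
  rw [h2, LinearMap.zero_apply, eq_comm, smul_eq_zero_iff_left hx.2, eval_map_algebraMap,
    AdjoinRoot.aeval_eq, AdjoinRoot.mk_eq_zero] at h1
  exact h1

theorem minpoly_eq_charpoly_of_squarefree (φ : Module.End K V) (h : Squarefree φ.charpoly) :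
    minpoly K φ = φ.charpoly := by
  refine eq_of_monic_of_associated (minpoly.monic (LinearMap.isIntegral φ)) φ.charpoly_monic
    (associated_of_dvd_dvd (LinearMap.minpoly_dvd_charpoly φ) ?_)
  exact dvd_of_squarefree_of_irreducible_dvd h (minpoly.ne_zero (LinearMap.isIntegral φ))
    fun p hp => irreducible_dvd_minpoly_of_dvd_charpoly φ hp

theorem exists_cyclic_vector (φ : Module.End K V) (h : Squarefree φ.charpoly) :
    ∃ v : V, ∀ p : K[X], aeval φ p v = 0 ↔ φ.charpoly ∣ p := by
  obtain ⟨x, hx⟩ := Module.exists_ker_toSpanSingleton_eq_annihilator K[X] (Module.AEval' φ)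
  obtain ⟨v, rfl⟩ := (Module.AEval'.of φ).surjective x
  refine ⟨v, fun p => ?_⟩
  rw [← span_minpoly_eq_annihilator, minpoly_eq_charpoly_of_squarefree φ h] at hx
  rw [← Ideal.mem_span_singleton, ← hx, LinearMap.mem_ker, LinearMap.toSpanSingleton_apply,
    ← Module.AEval.of_aeval_smul]
  simp

theorem exists_adjoinRoot_equiv (φ : Module.End K V) {f : K[X]} (hf : φ.charpoly = f)
    (h : Squarefree f) :
    ∃ θ : AdjoinRoot f ≃ₗ[K] V, ∀ x, θ (AdjoinRoot.root f * x) = φ (θ x) := by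
  subst hf
  obtain ⟨v, hv⟩ := exists_cyclic_vector φ h
  let L : AdjoinRoot φ.charpoly →ₐ[K] Module.End K V :=
    Ideal.Quotient.liftₐ (Ideal.span {φ.charpoly}) (aeval φ) (fun a ha => by
      obtain ⟨b, rfl⟩ := Ideal.mem_span_singleton.1 ha
      rw [map_mul, LinearMap.aeval_self_charpoly, zero_mul])
  have hL : ∀ p, L (AdjoinRoot.mk _ p) = aeval φ p := fun p => rfl
  let T : AdjoinRoot φ.charpoly →ₗ[K] V := (LinearMap.applyₗ v) ∘ₗ L.toLinearMap
  have hT : ∀ p, T (AdjoinRoot.mk _ p) = aeval φ p v := fun p => rfl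
  have hinj : Function.Injective T := by
    rw [← LinearMap.ker_eq_bot, LinearMap.ker_eq_bot']
    intro x
    obtain ⟨p, rfl⟩ := AdjoinRoot.mk_surjective x
    rw [hT, hv, AdjoinRoot.mk_eq_zero]
    exact id
  have hf0 := φ.charpoly_monic.ne_zero
  have := (AdjoinRoot.powerBasis hf0).finite
  refine ⟨LinearEquiv.ofInjectiveOfFinrankEq T hinj ?_, fun x => ?_⟩
  · rw [(AdjoinRoot.powerBasis hf0).finrank, AdjoinRoot.powerBasis_dim,
      LinearMap.charpoly_natDegree]
  · change (L (AdjoinRoot.root _ * x)) v = φ (L x v)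
    rw [map_mul, AdjoinRoot.root, hL, aeval_X]
    rfl

theorem charpoly_mul_root {f : K[X]} (hf : f.Monic) :
    haveI := (AdjoinRoot.powerBasis hf.ne_zero).finite
    (LinearMap.mulLeft K (AdjoinRoot.root f)).charpoly = f := by
  have := (AdjoinRoot.powerBasis hf.ne_zero).finite
  have h := charpoly_leftMulMatrix (AdjoinRoot.powerBasis hf.ne_zero)
  rw [AdjoinRoot.minpoly_powerBasis_gen, hf.leadingCoeff, inv_one, C_1, mul_one,
    Algebra.leftMulMatrix_apply, LinearMap.charpoly_toMatrix] at h
  exact h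

variable (V) in
theorem card_charpoly_eq_mul_card_units {f : K[X]} (hf : f.Monic) (hs : Squarefree f) :
    Nat.card {φ : Module.End K V // φ.charpoly = f} * Nat.card (AdjoinRoot f)ˣ
      = Nat.card (AdjoinRoot f ≃ₗ[K] V) := by
  have := (AdjoinRoot.powerBasis hf.ne_zero).finite
  choose θ hθ using fun φ : {φ : Module.End K V // φ.charpoly = f} =>
    exists_adjoinRoot_equiv φ.1 φ.2 hs
  rw [← Nat.card_prod]
  refine Nat.card_congr (Equiv.ofBijective
    (fun x => (LinearEquiv.ofBijective (LinearMap.mulLeft K (x.2 : AdjoinRoot f))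
      (Units.mulLeft_bijective x.2)).trans (θ x.1)) ⟨?_, ?_⟩)
  · rintro ⟨φ, u⟩ ⟨ψ, w⟩ h
    have h' : ∀ x, θ φ (u * x) = θ ψ (w * x) := fun x => congrArg (fun e => e x) h
    have hφψ : φ = ψ := by
      ext v
      obtain ⟨x, rfl⟩ := (θ φ).surjective v
      obtain ⟨y, rfl⟩ := (Units.mulLeft_bijective u).2 x
      have h2 := h' (AdjoinRoot.root f * y)
      rw [mul_left_comm, mul_left_comm (w : AdjoinRoot f), hθ, hθ, ← h'] at h2
      exact h2
    subst hφψ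
    have := (θ φ).injective (h' 1)
    simp only [mul_one] at this
    rw [Units.ext this]
  · intro e
    let φ : {φ : Module.End K V // φ.charpoly = f} :=
      ⟨e.conj (LinearMap.mulLeft K (AdjoinRoot.root f)), by
        rw [LinearEquiv.charpoly_conj, charpoly_mul_root hf]⟩
    have hφ : ∀ x, e (AdjoinRoot.root f * x) = φ.1 (e x) := fun x => by
      simp [φ, LinearEquiv.conj_apply]
    let ψ : AdjoinRoot f ≃ₗ[K] AdjoinRoot f := e.trans (θ φ).symm
    have hψ : ∀ x, ψ (AdjoinRoot.root f * x) = AdjoinRoot.root f * ψ x := fun x => by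
      apply (θ φ).injective
      simp only [ψ, LinearEquiv.trans_apply, LinearEquiv.apply_symm_apply, hθ, hφ]
    have hmul : ∀ x, ψ x = ψ 1 * x := by
      intro x
      obtain ⟨p, rfl⟩ := AdjoinRoot.mk_surjective x
      induction p using Polynomial.induction_on' with
      | add p q hp hq => rw [map_add, map_add, hp, hq, mul_add]
      | monomial n a =>
        rw [← C_mul_X_pow_eq_monomial, map_mul, map_pow, AdjoinRoot.mk_X, AdjoinRoot.mk_C,
          ← AdjoinRoot.algebraMap_eq, ← Algebra.smul_def, map_smul, mul_smul_comm]
        congr 1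
        induction n with
        | zero => simp
        | succ n ih => rw [pow_succ', hψ, ih, mul_left_comm]
    obtain ⟨y, hy⟩ := ψ.surjective 1
    rw [hmul] at hy
    refine ⟨(φ, Units.mkOfMulEqOne _ _ hy), ?_⟩
    ext x
    change θ φ (ψ 1 * x) = e x
    rw [← hmul]
    simp [ψ]

end CyclicCount

section Matrices

variable {F : Type} [Field F]

/-- The affine group element with linear part `A` and first row `(1, r)`. -/
def affMatrix {n : ℕ} (r : Fin n → F) (A : Matrix (Fin n) (Fin n) F) :
    Matrix (Fin (n + 1)) (Fin (n + 1)) F :=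
  Matrix.of (Fin.cons (Fin.cons 1 r) fun i => Fin.cons 0 (A i))

theorem charpoly_affMatrix {n : ℕ} (r : Fin n → F) (A : Matrix (Fin n) (Fin n) F) :
    (affMatrix r A).charpoly = (X - 1) * A.charpoly := by
  rw [Matrix.charpoly, Matrix.det_succ_column_zero, Fin.sum_univ_succ, Finset.sum_eq_zero]
  · have : (affMatrix r A).charmatrix.submatrix (Fin.succAbove 0) Fin.succ = A.charmatrix := by
      ext i j : 2
      by_cases h : i = j <;> simp [affMatrix, h]
    rw [this]
    simp [affMatrix, Matrix.charpoly]
  · intro i _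
    simp [affMatrix]

theorem det_affMatrix {n : ℕ} (r : Fin n → F) (A : Matrix (Fin n) (Fin n) F) :
    (affMatrix r A).det = A.det := by
  rw [Matrix.det_succ_column_zero, Fin.sum_univ_succ, Finset.sum_eq_zero]
  · have : (affMatrix r A).submatrix (Fin.succAbove 0) Fin.succ = A := by
      ext i j
      simp [affMatrix]
    rw [this]
    simp [affMatrix]
  · intro i _
    simp [affMatrix]

theorem eq_affMatrix_of_isAff {n : ℕ} (x : GL (Fin (n + 1)) F) (hx : IsAff x) :
    x.val = affMatrix (fun j => x.val 0 j.succ) (x.val.submatrix Fin.succ Fin.succ) := by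
  ext i j
  refine Fin.cases ?_ (fun i => ?_) i <;> refine Fin.cases ?_ (fun j => ?_) j
  · simpa [affMatrix] using hx.1
  · simp [affMatrix]
  · simpa [affMatrix] using hx.2 _ (Fin.succ_ne_zero i)
  · simp [affMatrix]

theorem card_isAff_and (n : ℕ) (P : F[X] → Prop) :
    Nat.card {x : GL (Fin (n + 1)) F // IsAff x ∧ P x.val.charpoly} =
      Nat.card {A : GL (Fin n) F // P ((X - 1) * A.val.charpoly)} * Nat.card (Fin n → F) := by
  rw [← Nat.card_prod]
  symm
  have hdet : ∀ (r : Fin n → F) (A : GL (Fin n) F), (affMatrix r A.val).det ≠ 0 := fun r A => by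
    rw [det_affMatrix]
    exact A.det_ne_zero
  refine Nat.card_congr (Equiv.ofBijective (fun y =>
    ⟨GeneralLinearGroup.mkOfDetNeZero (affMatrix y.2 y.1.1.val) (hdet _ _),
      ⟨rfl, fun j hj => ?_⟩, ?_⟩) ⟨?_, ?_⟩)
  · obtain ⟨i, rfl⟩ := Fin.exists_succ_eq.2 hj
    rfl
  · change P (affMatrix _ _).charpoly
    rw [charpoly_affMatrix]
    exact y.1.2
  · rintro ⟨⟨A, hA⟩, r⟩ ⟨⟨B, hB⟩, s⟩ h
    have h' : affMatrix r A.val = affMatrix s B.val := congrArg (fun z => z.1.val) h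
    have hr : r = s := by
      ext j
      simpa [affMatrix] using congrFun (congrFun h' 0) j.succ
    have hAB : A = B := by
      ext i j
      simpa [affMatrix] using congrFun (congrFun h' i.succ) j.succ
    subst hr hAB
    rfl
  · rintro ⟨x, hx, hP⟩
    have he := eq_affMatrix_of_isAff x hx
    have hd : (x.val.submatrix Fin.succ Fin.succ).det ≠ 0 := by
      rw [← det_affMatrix (fun j => x.val 0 j.succ), ← he]
      exact x.det_ne_zero
    refine ⟨(⟨GeneralLinearGroup.mkOfDetNeZero _ hd, ?_⟩, fun j => x.val 0 j.succ), ?_⟩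
    · change P ((X - 1) * (x.val.submatrix Fin.succ Fin.succ).charpoly)
      rw [← charpoly_affMatrix, ← he]
      exact hP
    · apply Subtype.ext
      apply Units.ext
      exact he.symm

/-- Squarefree polynomials that vanish at neither `0` nor `1`. -/
def Admissible (f : F[X]) : Prop :=
  Squarefree f ∧ f.eval 0 ≠ 0 ∧ f.eval 1 ≠ 0

theorem squarefree_X_sub_one_mul_iff (g : F[X]) :
    Squarefree ((X - 1) * g) ↔ Squarefree g ∧ g.eval 1 ≠ 0 := by
  have hirr : Irreducible (X - 1 : F[X]) := by
    simpa using irreducible_X_sub_C (1 : F)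
  have hdvd : (X - 1 : F[X]) ∣ g ↔ g.eval 1 = 0 := by
    simpa using dvd_iff_isRoot (p := g) (a := 1)
  rw [squarefree_mul_iff, hirr.isRelPrime_iff_not_dvd, hdvd, and_comm, and_assoc, ← ne_eq]
  exact and_iff_right_of_imp fun _ => hirr.squarefree

theorem card_admissible_GL [Fintype F] (n : ℕ) (S : Finset F[X])
    (hS : ∀ f, f ∈ S ↔ (f.Monic ∧ f.natDegree = n) ∧ Admissible f) :
    Nat.card {A : GL (Fin n) F // Squarefree ((X - 1) * A.val.charpoly)} =
      ∑ f ∈ S, Nat.card {φ : Module.End F (Fin n → F) // φ.charpoly = f} := by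
  have : Finite (Module.End F (Fin n → F)) := Module.finite_of_finite F
  rw [← Finset.sum_coe_sort, ← Nat.card_sigma]
  have hmem : ∀ A : GL (Fin n) F, Squarefree ((X - 1) * A.val.charpoly) →
      A.val.charpoly ∈ S := fun A hA => by
    rw [squarefree_X_sub_one_mul_iff] at hA
    refine (hS _).2 ⟨⟨A.val.charpoly_monic, ?_⟩, hA.1, ?_, hA.2⟩
    · rw [Matrix.charpoly_natDegree_eq_dim, Fintype.card_fin]
    · have := A.det_ne_zero
      rw [Matrix.det_eq_sign_charpoly_coeff, coeff_zero_eq_eval_zero] at this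
      exact right_ne_zero_of_mul this
  refine Nat.card_congr (Equiv.ofBijective (fun A =>
    ⟨⟨A.1.val.charpoly, hmem A.1 A.2⟩, Matrix.toLin' A.1.val, Matrix.charpoly_toLin' _⟩) ⟨?_, ?_⟩)
  · intro A B h
    have h' : Matrix.toLin' A.1.val = Matrix.toLin' B.1.val :=
      congrArg (fun z => (z.2 : Module.End F (Fin n → F))) h
    exact Subtype.ext (Units.ext (Matrix.toLin'.injective h'))
  · rintro ⟨⟨f, hf⟩, ⟨φ, hφ⟩⟩
    change φ.charpoly = f at hφ
    subst hφ
    obtain ⟨M, rfl⟩ := Matrix.toLin'.surjective φ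
    have hM := ((hS _).1 hf).2
    rw [Matrix.charpoly_toLin'] at hM
    have hd : M.det ≠ 0 := by
      rw [Matrix.det_eq_sign_charpoly_coeff, coeff_zero_eq_eval_zero]
      exact mul_ne_zero (pow_ne_zero _ (neg_ne_zero.2 one_ne_zero)) hM.2.1
    refine ⟨⟨GeneralLinearGroup.mkOfDetNeZero M hd, ?_⟩, ?_⟩
    · exact (squarefree_X_sub_one_mul_iff _).2 ⟨hM.1, hM.2.2⟩
    · refine Sigma.subtype_ext (Subtype.ext ?_) rfl
      exact (Matrix.charpoly_toLin' M).symm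

theorem finite_adjoinRoot [Finite F] {f : F[X]} (hf : f.Monic) : Finite (AdjoinRoot f) :=
  haveI := (AdjoinRoot.powerBasis hf.ne_zero).finite
  Module.finite_of_finite F

theorem card_adjoinRoot_equiv {n : ℕ} {f : F[X]} (hf : f.Monic) (hn : f.natDegree = n) :
    Nat.card (AdjoinRoot f ≃ₗ[F] (Fin n → F)) = Nat.card (GL (Fin n) F) := by
  have := (AdjoinRoot.powerBasis hf.ne_zero).finite
  have e : AdjoinRoot f ≃ₗ[F] (Fin n → F) := LinearEquiv.ofFinrankEq _ _ (by
    rw [(AdjoinRoot.powerBasis hf.ne_zero).finrank, AdjoinRoot.powerBasis_dim, hn,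
      Module.finrank_fin_fun])
  let c : (AdjoinRoot f ≃ₗ[F] (Fin n → F)) ≃ ((Fin n → F) ≃ₗ[F] (Fin n → F)) :=
    { toFun := fun θ => e.symm.trans θ
      invFun := fun ψ => e.trans ψ
      left_inv := fun θ => by ext; simp
      right_inv := fun ψ => by ext; simp }
  exact Nat.card_congr (c.trans ((LinearMap.GeneralLinearGroup.generalLinearEquiv F _).symm.trans
    Matrix.GeneralLinearGroup.toLin.symm).toEquiv)

/-- A separable element of `A(n,q)` is determined up to conjugacy by its characteristic polynomial
`(X - 1) f`, and `AdjoinRoot f` then describes the centralizer of its linear part. -/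
theorem sA_eq_sum [Fintype F] (n : ℕ) (S : Finset F[X])
    (hS : ∀ f, f ∈ S ↔ (f.Monic ∧ f.natDegree = n) ∧ Admissible f) :
    sA F n = ∑ f ∈ S, (Nat.card (AdjoinRoot f)ˣ : ℝ)⁻¹ := by
  have hall : Nat.card {x : GL (Fin (n + 1)) F // IsAff x} =
      Nat.card (GL (Fin n) F) * Nat.card (Fin n → F) := by
    have := card_isAff_and (F := F) n fun _ => True
    simpa only [and_true, Nat.card_congr (Equiv.subtypeUnivEquiv fun _ => trivial)] using this
  have hV : (Nat.card (Fin n → F) : ℝ) ≠ 0 := Nat.cast_ne_zero.2 Nat.card_pos.ne'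
  have hG : (Nat.card (GL (Fin n) F) : ℝ) ≠ 0 := Nat.cast_ne_zero.2 Nat.card_pos.ne'
  rw [sA, card_isAff_and, hall, card_admissible_GL n S hS, Nat.cast_mul, Nat.cast_mul,
    mul_div_mul_right _ _ hV, Nat.cast_sum, Finset.sum_div]
  refine Finset.sum_congr rfl fun f hf => ?_
  obtain ⟨⟨hm, hn⟩, ha⟩ := (hS f).1 hf
  have := finite_adjoinRoot hm
  have hU : (Nat.card (AdjoinRoot f)ˣ : ℝ) ≠ 0 := Nat.cast_ne_zero.2 Nat.card_pos.ne'
  have h := card_charpoly_eq_mul_card_units (Fin n → F) hm ha.1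
  rw [card_adjoinRoot_equiv hm hn] at h
  rw [← h, Nat.cast_mul] at hG ⊢
  field_simp [left_ne_zero_of_mul hG]

end Matrices

section Units

variable {F : Type} [Field F]

/-- The absolute value `q ^ deg f` of a polynomial over a field with `q` elements. -/
noncomputable def polyAbs (f : F[X]) : ℝ := (Nat.card F : ℝ) ^ f.natDegree

theorem polyAbs_one : polyAbs (1 : F[X]) = 1 := by simp [polyAbs]

theorem polyAbs_mul {f g : F[X]} (hf : f ≠ 0) (hg : g ≠ 0) :
    polyAbs (f * g) = polyAbs f * polyAbs g := by
  rw [polyAbs, natDegree_mul hf hg, pow_add, polyAbs, polyAbs]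

theorem polyAbs_pow (f : F[X]) (n : ℕ) : polyAbs (f ^ n) = polyAbs f ^ n := by
  rw [polyAbs, polyAbs, natDegree_pow, mul_comm, pow_mul]

theorem two_le_card (F : Type) [Field F] [Finite F] : (2 : ℝ) ≤ Nat.card F := by
  exact_mod_cast Finite.one_lt_card (α := F)

theorem polyAbs_pos [Finite F] (f : F[X]) : 0 < polyAbs f :=
  pow_pos (by linarith [two_le_card F]) _

theorem one_lt_polyAbs [Finite F] {f : F[X]} (hf : f.natDegree ≠ 0) : 1 < polyAbs f :=
  one_lt_pow₀ (by linarith [two_le_card F]) hf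

/-- The monic polynomials all of whose irreducible factors divide `r`. -/
def supportedOn (r : F[X]) : Set F[X] := {t | t.Monic ∧ ∃ k, t ∣ r ^ k}

theorem card_units_adjoinRoot_mul {f g : F[X]} (h : IsCoprime f g) :
    Nat.card (AdjoinRoot (f * g))ˣ = Nat.card (AdjoinRoot f)ˣ * Nat.card (AdjoinRoot g)ˣ := by
  have e : AdjoinRoot (f * g) ≃+* AdjoinRoot f × AdjoinRoot g :=
    (Ideal.quotEquivOfEq (Ideal.span_singleton_mul_span_singleton f g).symm).trans
      (Ideal.quotientMulEquivQuotientProd _ _ ((Ideal.isCoprime_span_singleton_iff f g).2 h))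
  rw [← Nat.card_prod]
  exact Nat.card_congr ((Units.mapEquiv e.toMulEquiv).trans MulEquiv.prodUnits).toEquiv

theorem card_units_adjoinRoot_of_irreducible [Finite F] {p : F[X]} (hm : p.Monic)
    (hp : Irreducible p) : (Nat.card (AdjoinRoot p)ˣ : ℝ) = polyAbs p - 1 := by
  have := Fact.mk hp
  have := finite_adjoinRoot hm
  have := (AdjoinRoot.powerBasis hm.ne_zero).finite
  have h := Nat.card_eq_card_units_add_one (AdjoinRoot p)
  rw [Module.natCard_eq_pow_finrank (K := F), (AdjoinRoot.powerBasis hm.ne_zero).finrank,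
    AdjoinRoot.powerBasis_dim] at h
  rw [polyAbs, eq_sub_iff_add_eq]
  exact_mod_cast h.symm

theorem le_of_pow_mul_eq_pow_mul {p s t : F[X]} (hp : p ≠ 0) (ht : ¬ p ∣ t) {i j : ℕ}
    (h : p ^ j * t = p ^ i * s) : i ≤ j := by
  by_contra! hij
  refine ht ((mul_dvd_mul_iff_left (pow_ne_zero j hp)).1 ?_)
  rw [h, ← pow_succ]
  exact (pow_dvd_pow p hij).mul_right s

/-- A polynomial supported on `p * r` is uniquely a power of `p` times one supported on `r`. -/
noncomputable def supportedOnMulEquiv {p r : F[X]} (hm : p.Monic) (hp : Irreducible p)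
    (hpr : ¬ p ∣ r) : ℕ × supportedOn r ≃ supportedOn (p * r) := by
  refine Equiv.ofBijective (fun x => ⟨p ^ x.1 * x.2.1, (hm.pow _).mul x.2.2.1, ?_⟩) ⟨?_, ?_⟩
  · obtain ⟨k, hk⟩ := x.2.2.2
    refine ⟨x.1 + k, ?_⟩
    rw [mul_pow]
    exact mul_dvd_mul (pow_dvd_pow _ (Nat.le_add_right _ _))
      (hk.trans (pow_dvd_pow _ (Nat.le_add_left _ _)))
  · rintro ⟨i, s, hs, k, hk⟩ ⟨j, t, ht, l, hl⟩ h
    have h' : p ^ i * s = p ^ j * t := congrArg Subtype.val h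
    have hps : ¬ p ∣ s := fun hd => hpr (hp.prime.dvd_of_dvd_pow (hd.trans hk))
    have hpt : ¬ p ∣ t := fun hd => hpr (hp.prime.dvd_of_dvd_pow (hd.trans hl))
    obtain rfl : i = j := le_antisymm (le_of_pow_mul_eq_pow_mul hm.ne_zero hpt h'.symm)
      (le_of_pow_mul_eq_pow_mul hm.ne_zero hps h')
    obtain rfl : s = t := mul_left_cancel₀ (pow_ne_zero _ hm.ne_zero) h'
    rfl
  · rintro ⟨t, ht, k, hk⟩
    obtain ⟨c, hc, hpc⟩ :=
      (FiniteMultiplicity.of_prime_left hp.prime ht.ne_zero).exists_eq_pow_mul_and_not_dvd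
    refine ⟨(multiplicity p t, ⟨c, (hm.pow _).of_mul_monic_left (hc ▸ ht), k, ?_⟩),
      Subtype.ext hc.symm⟩
    have hcop : IsCoprime c (p ^ k) := (hp.coprime_iff_not_dvd.2 hpc).symm.pow_right
    refine hcop.dvd_of_dvd_mul_left ?_
    rw [← mul_pow]
    exact (hc ▸ Dvd.intro_left _ rfl : c ∣ t).trans hk

/-- The Euler product for the reciprocal of the totient of a squarefree polynomial. -/
theorem hasSum_supportedOn [Finite F] (r : F[X]) (hr : r.Monic) (hs : Squarefree r) :
    HasSum (fun t : supportedOn r => (polyAbs t.1)⁻¹)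
      (polyAbs r / Nat.card (AdjoinRoot r)ˣ) := by
  induction hn : r.natDegree using Nat.strong_induction_on generalizing r with
  | _ n ih =>
    by_cases hu : IsUnit r
    · obtain rfl := hr.eq_one_of_isUnit hu
      have hT : ∀ t : supportedOn (1 : F[X]), t.1 = 1 := fun t => by
        obtain ⟨k, hk⟩ := t.2.2
        exact t.2.1.eq_one_of_isUnit (isUnit_of_dvd_one (by simpa using hk))
      let t₀ : supportedOn (1 : F[X]) := ⟨1, monic_one, 0, by simp⟩
      have hsub : Subsingleton (AdjoinRoot (1 : F[X])) := by
        rw [AdjoinRoot, Ideal.Quotient.subsingleton_iff, Ideal.span_singleton_one]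
      have := hasSum_single (f := fun t : supportedOn (1 : F[X]) => (polyAbs t.1)⁻¹) t₀
        fun t ht => (ht (Subtype.ext (hT t))).elim
      simpa [t₀, polyAbs_one] using this
    · obtain ⟨p, hpm, hp, r', rfl⟩ := exists_monic_irreducible_factor r hu
      have hrm : r'.Monic := hpm.of_mul_monic_left hr
      have hpr : ¬ p ∣ r' := fun h => hp.not_isUnit (hs p (mul_dvd_mul_left p h))
      have hdeg := natDegree_mul hpm.ne_zero hrm.ne_zero
      have h1 := ih r'.natDegree (by have := hp.natDegree_pos; omega) r' hrm
        (hs.squarefree_of_dvd (Dvd.intro_left _ rfl)) rfl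
      have hlt := one_lt_polyAbs hp.natDegree_pos.ne'
      have h2 := hasSum_geometric_of_lt_one (inv_nonneg.2 (polyAbs_pos p).le)
        (inv_lt_one_of_one_lt₀ hlt)
      have h3 := h2.mul h1 (h2.summable.mul_of_nonneg h1.summable
        (fun k => pow_nonneg (inv_nonneg.2 (polyAbs_pos p).le) k)
        (fun t => inv_nonneg.2 (polyAbs_pos _).le))
      rw [← (supportedOnMulEquiv hpm hp hpr).hasSum_iff]
      have hval : polyAbs (p * r') / Nat.card (AdjoinRoot (p * r'))ˣ =
          (1 - (polyAbs p)⁻¹)⁻¹ * (polyAbs r' / Nat.card (AdjoinRoot r')ˣ) := by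
        rw [card_units_adjoinRoot_mul (hp.coprime_iff_not_dvd.2 hpr), Nat.cast_mul,
          card_units_adjoinRoot_of_irreducible hpm hp, polyAbs_mul hpm.ne_zero hrm.ne_zero,
          mul_div_mul_comm]
        congr 1
        have : polyAbs p ≠ 0 := (polyAbs_pos p).ne'
        have : polyAbs p - 1 ≠ 0 := by linarith
        field_simp
      rw [hval]
      refine h3.congr_fun fun ⟨k, t⟩ => ?_
      change (polyAbs (p ^ k * t.1))⁻¹ = _
      rw [polyAbs_mul (pow_ne_zero _ hpm.ne_zero) t.2.1.ne_zero, polyAbs_pow, mul_inv, inv_pow]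

end Units

section Monics

variable {F : Type} [Field F]

open Classical in
theorem monic_radical (f : F[X]) : (radical f).Monic := by
  refine monic_prod_of_monic _ _ fun p hp => ?_
  rw [mem_primeFactors] at hp
  rw [id, ← normalize_normalized_factor p hp]
  exact monic_normalize (ne_zero_of_mem_normalizedFactors hp)

variable [Finite F]

variable (F) in
theorem finite_degree_lt (n : ℕ) : {a : F[X] | a.degree < n}.Finite := by
  have : Finite (degreeLT F n) := Finite.of_equiv _ (degreeLTEquiv F n).symm.toEquiv
  exact (Set.toFinite (degreeLT F n : Set F[X])).subset fun a ha => mem_degreeLT.2 ha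

variable (F) in
theorem finite_monic_natDegree_eq (n : ℕ) : {p : F[X] | p.Monic ∧ p.natDegree = n}.Finite :=
  (finite_degree_lt F (n + 1)).subset fun p hp =>
    degree_le_natDegree.trans_lt (by rw [hp.2]; exact_mod_cast n.lt_succ_self)

variable (F) in
/-- The monic polynomials of degree `n`. -/
noncomputable def monics (n : ℕ) : Finset F[X] := (finite_monic_natDegree_eq F n).toFinset

theorem mem_monics {n : ℕ} {p : F[X]} : p ∈ monics F n ↔ p.Monic ∧ p.natDegree = n :=
  Set.Finite.mem_toFinset _

variable (F) in
theorem card_monics (n : ℕ) : ((monics F n).card : ℝ) = (Nat.card F : ℝ) ^ n := by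
  have h1 : (monics F n).card = Nat.card {p : F[X] // p.Monic ∧ p.natDegree = n} :=
    (Nat.subtype_card _ fun _ => mem_monics).symm
  rw [h1, Nat.card_congr ((monicEquivDegreeLT n).trans (degreeLTEquiv F n).toEquiv), Nat.card_fun]
  simp

open Classical in
/-- A property that only depends on the residue class modulo `M` has constant density among the
monic polynomials of degree at least `deg M`. -/
theorem exists_density_of_periodic {M : F[X]} (hM : M.Monic) (Q : F[X] → Prop)
    (hQ : ∀ a c, Q (a + M * c) ↔ Q a) {n : ℕ} (hn : M.natDegree ≤ n) :
    (((monics F n).filter Q).card : ℝ) =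
      (((finite_degree_lt F M.natDegree).toFinset.filter Q).card / polyAbs M) *
        (Nat.card F : ℝ) ^ n := by
  have hcard : ((finite_degree_lt F M.natDegree).toFinset.filter Q ×ˢ
      monics F (n - M.natDegree)).card = ((monics F n).filter Q).card := by
    refine Finset.card_bij (fun x _ => x.1 + M * x.2) ?_ ?_ ?_
    · rintro ⟨a, h⟩ hx
      simp only [Finset.mem_product, Finset.mem_filter, Set.Finite.mem_toFinset,
        Set.mem_ofPred_eq, mem_monics] at hx ⊢
      obtain ⟨⟨ha, hQa⟩, hh, hd⟩ := hx
      have hMh := hM.mul hh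
      have hdeg : (M * h).natDegree = n := by
        rw [natDegree_mul hM.ne_zero hh.ne_zero, hd]; omega
      have hlt : a.degree < (M * h).degree := by
        rw [degree_eq_natDegree hMh.ne_zero, hdeg]
        exact ha.trans_le (by exact_mod_cast hn)
      refine ⟨⟨hMh.add_of_right hlt, ?_⟩, (hQ a h).2 hQa⟩
      rw [natDegree_add_eq_right_of_degree_lt hlt, hdeg]
    · rintro ⟨a, h⟩ hx ⟨b, k⟩ hy hab
      simp only [Finset.mem_product, Finset.mem_filter, Set.Finite.mem_toFinset,
        Set.mem_ofPred_eq] at hx hy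
      rw [← degree_eq_natDegree hM.ne_zero] at hx hy
      have h1 := div_modByMonic_unique h a hM ⟨rfl, hx.1.1⟩
      have h2 := div_modByMonic_unique k b hM ⟨rfl, hy.1.1⟩
      have hab' : a + M * h = b + M * k := hab
      rw [hab'] at h1
      exact Prod.ext (h1.2.symm.trans h2.2) (h1.1.symm.trans h2.1)
    · intro f hf
      rw [Finset.mem_filter, mem_monics] at hf
      have hle : M.degree ≤ f.degree := by
        rw [degree_eq_natDegree hM.ne_zero, degree_eq_natDegree hf.1.1.ne_zero, hf.1.2]
        exact_mod_cast hn
      refine ⟨(f %ₘ M, f /ₘ M), ?_, modByMonic_add_div f M⟩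
      simp only [Finset.mem_product, Finset.mem_filter, Set.Finite.mem_toFinset,
        Set.mem_ofPred_eq, mem_monics]
      rw [← degree_eq_natDegree hM.ne_zero, natDegree_divByMonic f hM, hf.1.2]
      refine ⟨⟨degree_modByMonic_lt f hM, ?_⟩, ?_, rfl⟩
      · rw [← hQ _ (f /ₘ M), modByMonic_add_div]
        exact hf.2
      · rw [Monic, leadingCoeff_divByMonic_of_monic hM hle, hf.1.1]
  have hq : (Nat.card F : ℝ) ≠ 0 := by linarith [two_le_card F]
  rw [← hcard, Finset.card_product, Nat.cast_mul, card_monics, polyAbs, pow_sub₀ _ hq hn]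
  ring

open Classical in
theorem card_filter_dvd {N : F[X]} (hN : N.Monic) {n : ℕ} (hn : N.natDegree ≤ n) :
    (((monics F n).filter (N ∣ ·)).card : ℝ) = (polyAbs N)⁻¹ * (Nat.card F : ℝ) ^ n := by
  rw [exists_density_of_periodic hN (N ∣ ·) (fun a c => dvd_add_left (dvd_mul_right N c)) hn]
  have : (finite_degree_lt F N.natDegree).toFinset.filter (N ∣ ·) = {0} := by
    ext a
    simp only [Finset.mem_filter, Set.Finite.mem_toFinset, Set.mem_ofPred_eq,
      Finset.mem_singleton, ← degree_eq_natDegree hN.ne_zero]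
    constructor
    · rintro ⟨h, hd⟩
      exact eq_zero_of_dvd_of_degree_lt hd h
    · rintro rfl
      exact ⟨degree_zero (R := F) ▸ bot_lt_iff_ne_bot.2 (degree_ne_bot.2 hN.ne_zero), dvd_zero N⟩
  rw [this]
  simp

open Classical in
theorem card_filter_dvd_le {N : F[X]} (hN : N.Monic) (n : ℕ) :
    (((monics F n).filter (N ∣ ·)).card : ℝ) ≤ (polyAbs N)⁻¹ * (Nat.card F : ℝ) ^ n := by
  rcases le_or_gt N.natDegree n with hn | hn
  · exact (card_filter_dvd hN hn).le
  · rw [Finset.filter_false_of_mem]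
    · have := polyAbs_pos N
      simp only [Finset.card_empty, Nat.cast_zero]
      positivity
    · intro f hf hd
      rw [mem_monics] at hf
      have := natDegree_le_of_dvd hd hf.1.ne_zero
      omega

/-- Polynomials that vanish at neither `0` nor `1`. -/
def NonvanishingAtZeroOne (f : F[X]) : Prop := f.eval 0 ≠ 0 ∧ f.eval 1 ≠ 0

open Classical in
theorem card_filter_nonvanishing {n : ℕ} (hn : 2 ≤ n) :
    (((monics F n).filter NonvanishingAtZeroOne).card : ℝ) / (Nat.card F : ℝ) ^ n =
      (1 - (Nat.card F : ℝ)⁻¹) ^ 2 := by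
  have hX1 : (X - 1 : F[X]).Monic := by simpa using monic_X_sub_C (1 : F)
  have hd1 : (X - 1 : F[X]).natDegree = 1 := by simpa using natDegree_X_sub_C (1 : F)
  have hcop : IsCoprime (X : F[X]) (X - 1) := ⟨1, -1, by ring⟩
  have hev0 : ∀ f : F[X], X ∣ f ↔ f.eval 0 = 0 := fun f => by
    rw [X_dvd_iff, coeff_zero_eq_eval_zero]
  have hev1 : ∀ f : F[X], X - 1 ∣ f ↔ f.eval 1 = 0 := fun f => by
    simpa using dvd_iff_isRoot (p := f) (a := 1)
  have hq : (Nat.card F : ℝ) ≠ 0 := by linarith [two_le_card F]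
  have c0 := card_filter_dvd (F := F) monic_X (n := n) (by rw [natDegree_X]; omega)
  have c1 := card_filter_dvd hX1 (n := n) (by omega)
  have c2 := card_filter_dvd (monic_X.mul hX1) (n := n)
    (by rw [natDegree_mul X_ne_zero hX1.ne_zero, hd1, natDegree_X]; omega)
  have hI : (monics F n).filter (X ∣ ·) ∩ (monics F n).filter (X - 1 ∣ ·) =
      (monics F n).filter (X * (X - 1) ∣ ·) := by
    rw [← Finset.filter_and]
    refine Finset.filter_congr fun f _ =>
      ⟨fun h => hcop.mul_dvd h.1 h.2, fun h => ⟨dvd_of_mul_right_dvd h, dvd_of_mul_left_dvd h⟩⟩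
  have hU := Finset.card_union_add_card_inter ((monics F n).filter (X ∣ ·))
    ((monics F n).filter (X - 1 ∣ ·))
  rw [hI, ← Finset.filter_or] at hU
  have hC := Finset.card_filter_add_card_filter_not (s := monics F n)
    (fun f => X ∣ f ∨ X - 1 ∣ f)
  have hN : (monics F n).filter (fun f => ¬ (X ∣ f ∨ X - 1 ∣ f)) =
      (monics F n).filter NonvanishingAtZeroOne :=
    Finset.filter_congr fun f _ => by rw [hev0, hev1, not_or]; rfl
  rw [hN] at hC
  have hU' := congrArg (Nat.cast (R := ℝ)) hU
  have hC' := congrArg (Nat.cast (R := ℝ)) hC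
  push_cast at hU' hC'
  rw [c0, c1, c2] at hU'
  rw [card_monics] at hC'
  rw [polyAbs_mul X_ne_zero hX1.ne_zero] at hU'
  simp only [polyAbs, natDegree_X, hd1, pow_one] at hU'
  rw [div_eq_iff (pow_ne_zero _ hq), ← sub_eq_iff_eq_add'.2 hC'.symm, eq_sub_of_add_eq hU']
  field_simp
  ring

end Monics

section Sieve

variable {F : Type} [Field F]

theorem nonvanishingAtZeroOne_iff_not_dvd (f : F[X]) :
    NonvanishingAtZeroOne f ↔ ¬ X ∣ f ∧ ¬ X - 1 ∣ f := by
  have h1 : X - 1 ∣ f ↔ f.eval 1 = 0 := by simpa using dvd_iff_isRoot (p := f) (a := 1)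
  rw [X_dvd_iff, coeff_zero_eq_eval_zero, h1]
  rfl

theorem exists_monic_sq_dvd {f : F[X]} (h : ¬ Squarefree f) :
    ∃ d : F[X], d.Monic ∧ d.natDegree ≠ 0 ∧ d ^ 2 ∣ f := by
  rw [Squarefree] at h
  push Not at h
  obtain ⟨x, hx, hu⟩ := h
  obtain ⟨p, hpm, hp, hpx⟩ := exists_monic_irreducible_factor x hu
  exact ⟨p, hpm, hp.natDegree_pos.ne', (sq p).symm ▸ (mul_dvd_mul hpx hpx).trans hx⟩

open Classical in
theorem mem_supportedOn_iff {t : F[X]} (ht : t.Monic) (r : F[X]) :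
    t ∈ supportedOn r ↔ radical t ∣ r :=
  (and_iff_right ht).trans (exists_dvd_pow_iff_radical_dvd ht.ne_zero)

variable [Finite F]

open Classical in
/-- The proportion, among monic polynomials of degree `n`, of admissible ones whose
irreducible factors include all those of `t`. -/
noncomputable def supportDensity (n : ℕ) (t : F[X]) : ℝ :=
  ((monics F n).filter fun r => Admissible r ∧ t ∈ supportedOn r).card / (Nat.card F : ℝ) ^ n

/-- The conditions for admissibility and divisibility by `s`, with squarefreeness only tested
against divisors of degree at most `y`. -/
def SieveCondition (s : F[X]) (y : ℕ) (r : F[X]) : Prop :=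
  s ∣ r ∧ NonvanishingAtZeroOne r ∧ ∀ j ∈ Finset.Icc 1 y, ∀ d ∈ monics F j, ¬ d ^ 2 ∣ r

/-- A modulus for `SieveCondition s y`. -/
noncomputable def sieveModulus (s : F[X]) (y : ℕ) : F[X] :=
  s * (X * (X - 1)) * ∏ j ∈ Finset.Icc 1 y, ∏ d ∈ monics F j, d ^ 2

theorem monic_sieveModulus {s : F[X]} (hs : s.Monic) (y : ℕ) : (sieveModulus s y).Monic :=
  (hs.mul (monic_X.mul (by simpa using monic_X_sub_C (1 : F)))).mul
    (monic_prod_of_monic _ _ fun _ _ => monic_prod_of_monic _ _ fun _ hd =>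
      (mem_monics.1 hd).1.pow 2)

theorem sieveCondition_add_mul_iff (s : F[X]) (y : ℕ) (a c : F[X]) :
    SieveCondition s y (a + sieveModulus s y * c) ↔ SieveCondition s y a := by
  have key : ∀ N, N ∣ sieveModulus s y → (N ∣ a + sieveModulus s y * c ↔ N ∣ a) :=
    fun N hN => dvd_add_left (hN.mul_right c)
  have hs : s ∣ sieveModulus s y := ((dvd_mul_right _ _).mul_right _)
  have hX : X ∣ sieveModulus s y := ((dvd_mul_right _ _).mul_left _).mul_right _
  have hX1 : X - 1 ∣ sieveModulus s y := ((dvd_mul_left _ _).mul_left _).mul_right _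
  simp only [SieveCondition, nonvanishingAtZeroOne_iff_not_dvd, key _ hs, key _ hX, key _ hX1]
  refine and_congr_right fun _ => and_congr_right fun _ => forall₂_congr fun j hj =>
    forall₂_congr fun d hd => not_congr (key _ ?_)
  exact ((Finset.dvd_prod_of_mem (fun d => d ^ 2) hd).trans
    (Finset.dvd_prod_of_mem (fun j => ∏ d ∈ monics F j, d ^ 2) hj)).mul_left _

theorem sum_Ioc_inv_two_pow_le (y n : ℕ) :
    ∑ j ∈ Finset.Ioc y n, ((2 : ℝ)⁻¹) ^ j ≤ (2 : ℝ)⁻¹ ^ y := by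
  rcases le_or_gt y n with h | h
  · suffices ∑ j ∈ Finset.Ioc y n, ((2 : ℝ)⁻¹) ^ j = (2 : ℝ)⁻¹ ^ y - (2 : ℝ)⁻¹ ^ n by
      rw [this]
      have : (0 : ℝ) ≤ 2⁻¹ ^ n := by positivity
      linarith
    induction n, h using Nat.le_induction with
    | base => simp
    | succ n hn ih =>
      rw [Finset.sum_Ioc_succ_top (by omega), ih]
      ring
  · rw [Finset.Ioc_eq_empty (by omega), Finset.sum_empty]
    positivity

open Classical in
theorem card_sieve_le {t : F[X]} (ht : t.Monic) (n y : ℕ) :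
    (((monics F n).filter (SieveCondition (radical t) y)).card : ℝ) ≤
      ((monics F n).filter fun r => Admissible r ∧ t ∈ supportedOn r).card +
        (2 : ℝ)⁻¹ ^ y * (Nat.card F : ℝ) ^ n := by
  have hsub : (monics F n).filter (SieveCondition (radical t) y) ⊆
      ((monics F n).filter fun r => Admissible r ∧ t ∈ supportedOn r) ∪
        (Finset.Ioc y n).biUnion fun j => (monics F j).biUnion fun d =>
          (monics F n).filter (d ^ 2 ∣ ·) := by
    intro r hr
    rw [Finset.mem_filter] at hr
    obtain ⟨hr, hs, hv, hd⟩ := hr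
    rw [Finset.mem_union]
    by_cases hsq : Squarefree r
    · exact Or.inl (Finset.mem_filter.2 ⟨hr, ⟨hsq, hv⟩, (mem_supportedOn_iff ht r).2 hs⟩)
    · right
      obtain ⟨d, hdm, hd0, hdr⟩ := exists_monic_sq_dvd hsq
      simp only [Finset.mem_biUnion]
      refine ⟨d.natDegree, ?_, d, mem_monics.2 ⟨hdm, rfl⟩, Finset.mem_filter.2 ⟨hr, hdr⟩⟩
      rw [Finset.mem_Ioc]
      constructor
      · by_contra! hle
        exact hd _ (Finset.mem_Icc.2 ⟨Nat.one_le_iff_ne_zero.2 hd0, hle⟩) d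
          (mem_monics.2 ⟨hdm, rfl⟩) hdr
      · have h1 := natDegree_le_of_dvd hdr (mem_monics.1 hr).1.ne_zero
        rw [natDegree_pow, (mem_monics.1 hr).2] at h1
        omega
  have hq := two_le_card F
  have hq0 : (0 : ℝ) < Nat.card F := by linarith
  refine (Nat.cast_le.2 ((Finset.card_le_card hsub).trans (Finset.card_union_le _ _))).trans ?_
  rw [Nat.cast_add, add_le_add_iff_left]
  calc (((Finset.Ioc y n).biUnion fun j => (monics F j).biUnion fun d =>
          (monics F n).filter (d ^ 2 ∣ ·)).card : ℝ)
      ≤ ∑ j ∈ Finset.Ioc y n, ∑ d ∈ monics F j, (((monics F n).filter (d ^ 2 ∣ ·)).card : ℝ) := by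
        exact_mod_cast Finset.card_biUnion_le.trans
          (Finset.sum_le_sum fun j _ => Finset.card_biUnion_le)
    _ ≤ ∑ j ∈ Finset.Ioc y n, (2 : ℝ)⁻¹ ^ j * (Nat.card F : ℝ) ^ n := by
        refine Finset.sum_le_sum fun j _ => ?_
        calc ∑ d ∈ monics F j, (((monics F n).filter (d ^ 2 ∣ ·)).card : ℝ)
            ≤ ∑ d ∈ monics F j, (((Nat.card F : ℝ) ^ j) ^ 2)⁻¹ * (Nat.card F : ℝ) ^ n := by
              refine Finset.sum_le_sum fun d hd => ?_
              rw [mem_monics] at hd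
              have := card_filter_dvd_le (hd.1.pow 2) n
              rwa [polyAbs_pow, polyAbs, hd.2] at this
          _ = ((Nat.card F : ℝ)⁻¹) ^ j * (Nat.card F : ℝ) ^ n := by
              rw [Finset.sum_const, nsmul_eq_mul, card_monics, inv_pow]
              have : (Nat.card F : ℝ) ^ j ≠ 0 := (pow_pos hq0 j).ne'
              field_simp
          _ ≤ (2 : ℝ)⁻¹ ^ j * (Nat.card F : ℝ) ^ n := by gcongr
    _ ≤ (2 : ℝ)⁻¹ ^ y * (Nat.card F : ℝ) ^ n := by
        rw [← Finset.sum_mul]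
        gcongr
        exact sum_Ioc_inv_two_pow_le y n

open Classical in
/-- The densities `supportDensity n t` converge, by sieving out squares of small degree. -/
theorem cauchySeq_supportDensity {t : F[X]} (ht : t.Monic) :
    CauchySeq fun n => supportDensity n t := by
  have hq0 : (0 : ℝ) < Nat.card F := by linarith [two_le_card F]
  refine Metric.cauchySeq_iff.2 fun ε hε => ?_
  obtain ⟨y, hy⟩ := exists_pow_lt_of_lt_one hε (by norm_num : (2 : ℝ)⁻¹ < 1)
  set M := sieveModulus (radical t) y with hM
  set c : ℝ := ((finite_degree_lt F M.natDegree).toFinset.filter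
    (SieveCondition (radical t) y)).card / polyAbs M
  have key : ∀ n ≥ M.natDegree, c - (2 : ℝ)⁻¹ ^ y ≤ supportDensity n t ∧
      supportDensity n t ≤ c := by
    intro n hn
    have h1 := exists_density_of_periodic (monic_sieveModulus (monic_radical t) y)
      (SieveCondition (radical t) y) (sieveCondition_add_mul_iff _ y) hn
    have hqn : (0 : ℝ) < (Nat.card F : ℝ) ^ n := pow_pos hq0 n
    constructor
    · rw [supportDensity, le_div_iff₀ hqn, sub_mul, sub_le_iff_le_add]
      exact h1.symm.le.trans (card_sieve_le ht n y)
    · rw [supportDensity, div_le_iff₀ hqn]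
      refine le_trans ?_ h1.le
      gcongr with r hr
      rintro ⟨⟨hsq, hv⟩, hs⟩
      refine ⟨(mem_supportedOn_iff ht r).1 hs, hv, fun j hj d hd hdr => ?_⟩
      have hu : IsUnit d := hsq d ((sq d) ▸ hdr)
      rw [mem_monics] at hd
      rw [hd.1.eq_one_of_isUnit hu, natDegree_one] at hd
      rw [Finset.mem_Icc] at hj
      omega
  refine ⟨M.natDegree, fun m hm n hn => ?_⟩
  rw [Real.dist_eq, abs_lt]
  constructor <;> linarith [key m hm, key n hn]

end Sieve

section Limit

variable {F : Type} [Field F]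

open Classical in
theorem radical_mul_of_mem_supportedOn {t r : F[X]} (hr : r.Monic) (hs : Squarefree r)
    (ht : t ∈ supportedOn r) : radical (t * r) = r := by
  obtain ⟨htm, k, hk⟩ := ht
  refine eq_of_monic_of_associated (monic_radical _) hr (associated_of_dvd_dvd ?_ ?_)
  · have h1 : t * r ∣ r ^ (k + 1) := pow_succ r k ▸ mul_dvd_mul_right hk r
    exact (radical_dvd_radical h1 (pow_ne_zero _ hr.ne_zero)).trans
      (radical_pow_dvd.trans radical_dvd_self)
  · exact (dvd_radical_iff hs.isRadical (htm.mul hr).ne_zero).2 (dvd_mul_left r t)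

theorem exists_squarefree_mul_sq (t : F[X]) (ht : t.Monic) :
    ∃ u v : F[X], u.Monic ∧ v.Monic ∧ Squarefree u ∧ t = u * v ^ 2 := by
  induction h : t.natDegree using Nat.strong_induction_on generalizing t with
  | _ n ih =>
    by_cases hsq : Squarefree t
    · exact ⟨t, 1, ht, monic_one, hsq, by simp⟩
    · obtain ⟨d, hd, hd0, s, rfl⟩ := exists_monic_sq_dvd hsq
      have hs : s.Monic := (hd.pow 2).of_mul_monic_left ht
      rw [natDegree_mul (hd.pow 2).ne_zero hs.ne_zero, natDegree_pow] at h
      obtain ⟨u, v, hu, hv, hus, rfl⟩ := ih s.natDegree (by omega) s hs rfl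
      exact ⟨u, d * v, hu, hd.mul hv, hus, by ring⟩

open Classical in
/-- A common summable bound for the terms of the two series to be compared. -/
noncomputable def bound (t : F[X]) : ℝ :=
  {t : F[X] | t.Monic}.indicator (fun t => (polyAbs t)⁻¹ * (polyAbs (radical t))⁻¹) t

open Classical in
theorem bound_of_monic {t : F[X]} (ht : t.Monic) :
    bound t = (polyAbs t)⁻¹ * (polyAbs (radical t))⁻¹ :=
  Set.indicator_of_mem (s := {t : F[X] | t.Monic}) ht _

theorem bound_of_not_monic {t : F[X]} (ht : ¬ t.Monic) : bound t = 0 :=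
  Set.indicator_of_notMem (s := {t : F[X] | t.Monic}) ht _

variable [Finite F]

variable (F) in
theorem sum_monics_inv_polyAbs_sq (n : ℕ) :
    ∑ u ∈ monics F n, (polyAbs u ^ 2)⁻¹ = (Nat.card F : ℝ)⁻¹ ^ n := by
  rw [Finset.sum_congr rfl (g := fun _ => (((Nat.card F : ℝ) ^ n) ^ 2)⁻¹)
      fun u hu => by rw [polyAbs, (mem_monics.1 hu).2],
    Finset.sum_const, nsmul_eq_mul, card_monics, inv_pow]
  have : (Nat.card F : ℝ) ^ n ≠ 0 := pow_ne_zero _ (by linarith [two_le_card F])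
  field_simp

variable (F) in
theorem summable_inv_polyAbs_sq :
    Summable fun u : {u : F[X] // u.Monic} => ((polyAbs u.1) ^ 2)⁻¹ := by
  have hq := two_le_card F
  have hpos : ∀ f : F[X], 0 ≤ (polyAbs f ^ 2)⁻¹ := fun f => inv_nonneg.2 (sq_nonneg _)
  have key : Summable fun x : (n : ℕ) × monics F n => ((polyAbs x.2.1) ^ 2)⁻¹ := by
    refine (summable_sigma_of_nonneg fun x => hpos _).2 ⟨fun n => Summable.of_finite, ?_⟩
    refine (summable_geometric_of_lt_one (r := (Nat.card F : ℝ)⁻¹) (by positivity)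
      (inv_lt_one_of_one_lt₀ (by linarith))).congr fun n => ?_
    rw [← sum_monics_inv_polyAbs_sq F n]
    exact (Finset.tsum_subtype (monics F n) fun u => (polyAbs u ^ 2)⁻¹).symm
  obtain ⟨i, hi⟩ : ∃ i : {u : F[X] // u.Monic} → (n : ℕ) × monics F n, ∀ u, (i u).2.1 = u.1 :=
    ⟨fun u => ⟨u.1.natDegree, u.1, mem_monics.2 ⟨u.2, rfl⟩⟩, fun _ => rfl⟩
  have hinj : Function.Injective i := fun u v h => Subtype.ext (by rw [← hi u, ← hi v, h])
  exact (key.comp_injective hinj).congr fun u => by rw [Function.comp_apply, hi]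

variable (F) in
theorem summable_bound : Summable (bound : F[X] → ℝ) := by
  classical
  choose u v hu hv hus huv using
    fun t : {t : F[X] // t.Monic} => exists_squarefree_mul_sq t.1 t.2
  have hsum := (summable_inv_polyAbs_sq F).mul_of_nonneg (summable_inv_polyAbs_sq F)
    (fun _ => by positivity) (fun _ => by positivity)
  have hinj : Function.Injective fun t => ((⟨u t, hu t⟩, ⟨v t, hv t⟩) :
      {u : F[X] // u.Monic} × {u : F[X] // u.Monic}) := by
    intro s t h
    simp only [Prod.mk.injEq, Subtype.mk.injEq] at h
    exact Subtype.ext (by rw [huv s, huv t, h.1, h.2])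
  have : Summable fun t : {t : F[X] | t.Monic} =>
      (polyAbs t.1)⁻¹ * (polyAbs (radical t.1))⁻¹ := by
    refine Summable.of_nonneg_of_le (fun t => ?_) (fun t => ?_) (hsum.comp_injective hinj)
    · have := polyAbs_pos t.1
      have := polyAbs_pos (radical t.1)
      positivity
    · have hle : polyAbs (u t) ≤ polyAbs (radical t.1) := by
        refine pow_le_pow_right₀ (by linarith [two_le_card F])
          (natDegree_le_of_dvd ?_ (monic_radical _).ne_zero)
        exact (dvd_radical_iff (hus t).isRadical t.2.ne_zero).2 (Dvd.intro _ (huv t).symm)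
      have h1 : (polyAbs t.1)⁻¹ = (polyAbs (u t))⁻¹ * (polyAbs (v t) ^ 2)⁻¹ := by
        conv_lhs => rw [huv t]
        rw [polyAbs_mul (hu t).ne_zero ((hv t).pow 2).ne_zero, polyAbs_pow, mul_inv]
      have hup := polyAbs_pos (u t)
      calc (polyAbs t.1)⁻¹ * (polyAbs (radical t.1))⁻¹
          ≤ (polyAbs t.1)⁻¹ * (polyAbs (u t))⁻¹ := by
            have := polyAbs_pos t.1
            gcongr
        _ = _ := by
          rw [h1]
          simp only [Function.comp]
          ring
  exact summable_subtype_iff_indicator.1 this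

open Classical in
theorem supportDensity_bounds (n : ℕ) (t : F[X]) :
    0 ≤ (polyAbs t)⁻¹ * supportDensity n t ∧ (polyAbs t)⁻¹ * supportDensity n t ≤ bound t := by
  have hp := polyAbs_pos t
  have hq : (0 : ℝ) < Nat.card F := by linarith [two_le_card F]
  have h0 : 0 ≤ supportDensity n t := by rw [supportDensity]; positivity
  refine ⟨by positivity, ?_⟩
  by_cases ht : t.Monic
  · rw [bound_of_monic ht]
    gcongr
    rw [supportDensity, div_le_iff₀ (by positivity)]
    refine le_trans ?_ (card_filter_dvd_le (monic_radical t) n)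
    gcongr with r
    exact fun h => (mem_supportedOn_iff ht r).1 h.2
  · rw [bound_of_not_monic ht, supportDensity,
      Finset.filter_false_of_mem fun r _ h => ht h.2.1]
    simp

open Classical in
/-- The proportion, among monic polynomials of degree `n`, of those polynomials `g` vanishing at
neither `0` nor `1` whose quotient by their radical is `t`. -/
noncomputable def radicalDensity (n : ℕ) (t : F[X]) : ℝ :=
  ((monics F n).filter fun g => NonvanishingAtZeroOne g ∧ t * radical g = g).card /
    (Nat.card F : ℝ) ^ n

open Classical in
theorem radicalDensity_bounds (n : ℕ) (t : F[X]) :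
    0 ≤ radicalDensity n t ∧ radicalDensity n t ≤ bound t := by
  have hq : (0 : ℝ) < Nat.card F := by linarith [two_le_card F]
  refine ⟨by rw [radicalDensity]; positivity, ?_⟩
  by_cases ht : t.Monic
  · rw [bound_of_monic ht, radicalDensity, div_le_iff₀ (by positivity), ← mul_inv,
      ← polyAbs_mul ht.ne_zero (monic_radical t).ne_zero]
    refine le_trans ?_ (card_filter_dvd_le (ht.mul (monic_radical t)) n)
    gcongr with r hr
    rintro ⟨-, h⟩
    have hdvd := radical_dvd_radical (Dvd.intro _ h) (mem_monics.1 hr).1.ne_zero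
    exact (mul_dvd_mul_left t hdvd).trans h.dvd
  · rw [bound_of_not_monic ht, radicalDensity, Finset.filter_false_of_mem]
    · simp
    · rintro g hg ⟨-, h⟩
      exact ht ((monic_radical g).of_mul_monic_right (h.symm ▸ (mem_monics.1 hg).1))

open Classical in
theorem hasSum_radicalDensity (n : ℕ) :
    HasSum (fun t : F[X] => radicalDensity n t)
      (((monics F n).filter NonvanishingAtZeroOne).card / (Nat.card F : ℝ) ^ n) := by
  have h : HasSum (fun t : F[X] => ∑ g ∈ (monics F n).filter NonvanishingAtZeroOne,
      if t * radical g = g then ((Nat.card F : ℝ) ^ n)⁻¹ else 0)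
      (∑ g ∈ (monics F n).filter NonvanishingAtZeroOne, ((Nat.card F : ℝ) ^ n)⁻¹) := by
    refine hasSum_sum fun g _ => ?_
    obtain ⟨s, hs⟩ := radical_dvd_self (a := g)
    have : ∀ t, t * radical g = g ↔ t = s := fun t => by
      nth_rw 2 [hs]
      rw [mul_comm, mul_right_inj' (monic_radical g).ne_zero]
    simp only [this]
    exact hasSum_ite_eq s _
  simp only [Finset.sum_const, nsmul_eq_mul, ← Finset.sum_filter, Finset.filter_filter,
    ← div_eq_mul_inv] at h
  exact h

open Classical in
/-- The map `g ↦ radical g`, with inverse `r ↦ t * r`, compares the two densities. -/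
theorem radicalDensity_eq {t : F[X]} (ht : t.Monic) {n : ℕ} (hn : t.natDegree ≤ n) :
    radicalDensity n t = (polyAbs t)⁻¹ * supportDensity (n - t.natDegree) t := by
  have hcard : ((monics F n).filter
      fun g => NonvanishingAtZeroOne g ∧ t * radical g = g).card =
      ((monics F (n - t.natDegree)).filter
        fun r => Admissible r ∧ t ∈ supportedOn r).card := by
    refine Finset.card_nbij' radical (t * ·) ?_ ?_ ?_ ?_
    · intro g hg
      simp only [Finset.coe_filter, Set.mem_ofPred_eq, mem_monics] at hg ⊢
      obtain ⟨⟨hgm, hgd⟩, hv, h⟩ := hg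
      have hd := natDegree_mul ht.ne_zero (monic_radical g).ne_zero
      rw [h] at hd
      refine ⟨⟨monic_radical g, by omega⟩, ⟨squarefree_radical, ?_⟩,
        (mem_supportedOn_iff ht _).2 (radical_dvd_radical (Dvd.intro _ h) hgm.ne_zero)⟩
      refine ⟨fun h0 => hv.1 ?_, fun h1 => hv.2 ?_⟩
      · rw [← h, eval_mul, h0, mul_zero]
      · rw [← h, eval_mul, h1, mul_zero]
    · intro r hr
      simp only [Finset.coe_filter, Set.mem_ofPred_eq, mem_monics] at hr ⊢
      obtain ⟨⟨hrm, hrd⟩, ⟨hs, h0, h1⟩, hsup⟩ := hr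
      rw [radical_mul_of_mem_supportedOn hrm hs hsup, natDegree_mul ht.ne_zero hrm.ne_zero]
      obtain ⟨-, k, c, hk⟩ := hsup
      have hev : ∀ a, r.eval a ≠ 0 → (t * r).eval a ≠ 0 := fun a ha => by
        rw [eval_mul]
        refine mul_ne_zero (fun hta => pow_ne_zero k ha ?_) ha
        rw [← eval_pow, hk, eval_mul, hta, zero_mul]
      exact ⟨⟨ht.mul hrm, by omega⟩, ⟨hev 0 h0, hev 1 h1⟩, rfl⟩
    · intro g hg
      exact (Finset.mem_filter.1 hg).2.2
    · intro r hr
      obtain ⟨hrm, ha, hsup⟩ := Finset.mem_filter.1 hr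
      exact radical_mul_of_mem_supportedOn (mem_monics.1 hrm).1 ha.1 hsup
  have hq : (Nat.card F : ℝ) ≠ 0 := by linarith [two_le_card F]
  rw [radicalDensity, supportDensity, hcard, polyAbs, pow_sub₀ _ hq hn]
  field_simp

theorem tendsto_supportDensity_sub (t : F[X]) :
    Tendsto (fun n => (polyAbs t)⁻¹ * supportDensity n t - radicalDensity n t) atTop (𝓝 0) := by
  by_cases ht : t.Monic
  · obtain ⟨l, hl⟩ := cauchySeq_tendsto_of_complete (cauchySeq_supportDensity ht)
    have h := (hl.sub (hl.comp (tendsto_sub_atTop_nat t.natDegree))).const_mul (polyAbs t)⁻¹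
    rw [sub_self, mul_zero] at h
    refine h.congr' ?_
    filter_upwards [eventually_ge_atTop t.natDegree] with n hn
    rw [radicalDensity_eq ht hn, mul_sub]
    rfl
  · have hb : bound t = 0 := bound_of_not_monic ht
    refine tendsto_const_nhds.congr fun n => ?_
    linarith [supportDensity_bounds n t, radicalDensity_bounds n t]

end Limit

section

variable {F : Type} [Field F] [Fintype F]

open Classical in
theorem hasSum_supportDensity (n : ℕ) :
    HasSum (fun t : F[X] => (polyAbs t)⁻¹ * supportDensity n t) (sA F n) := by
  have hq : (Nat.card F : ℝ) ^ n ≠ 0 := pow_ne_zero _ (by linarith [two_le_card F])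
  rw [sA_eq_sum n ((monics F n).filter Admissible) fun f => by
    rw [Finset.mem_filter, mem_monics]]
  have h : HasSum (fun t : F[X] => ∑ r ∈ (monics F n).filter Admissible,
      (supportedOn r).indicator (fun t => (polyAbs t)⁻¹) t / (Nat.card F : ℝ) ^ n)
      (∑ r ∈ (monics F n).filter Admissible, (Nat.card (AdjoinRoot r)ˣ : ℝ)⁻¹) := by
    refine hasSum_sum fun r hr => ?_
    obtain ⟨hrm, ha⟩ := Finset.mem_filter.1 hr
    rw [mem_monics] at hrm
    have h1 := (hasSum_subtype_iff_indicator (f := fun t : F[X] => (polyAbs t)⁻¹)).1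
      (hasSum_supportedOn r hrm.1 ha.1)
    have h2 : polyAbs r = (Nat.card F : ℝ) ^ n := by rw [polyAbs, hrm.2]
    have h3 := h1.div_const ((Nat.card F : ℝ) ^ n)
    rwa [h2, div_div_cancel_left' hq] at h3
  refine h.congr_fun fun t => ?_
  rw [supportDensity, ← Finset.sum_div, ← Finset.filter_filter, ← mul_div_assoc]
  simp only [Set.indicator_apply]
  rw [← Finset.sum_filter, Finset.sum_const, nsmul_eq_mul, mul_comm]

theorem tendsto_sA : Tendsto (sA F) atTop (𝓝 ((1 - (Nat.card F : ℝ)⁻¹) ^ 2)) := by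
  classical
  have h : Tendsto (fun n => ∑' t : F[X],
      ((polyAbs t)⁻¹ * supportDensity n t - radicalDensity n t)) atTop (𝓝 (∑' _ : F[X], 0)) := by
    refine tendsto_tsum_of_dominated_convergence (summable_bound F) tendsto_supportDensity_sub
      (Eventually.of_forall fun n t => ?_)
    rw [Real.norm_eq_abs, abs_le]
    constructor <;> linarith [supportDensity_bounds n t, radicalDensity_bounds n t]
  rw [tsum_zero] at h
  have h2 := h.add_const ((1 - (Nat.card F : ℝ)⁻¹) ^ 2)
  rw [zero_add] at h2
  refine h2.congr' ?_
  filter_upwards [eventually_ge_atTop 2] with n hn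
  rw [((hasSum_supportDensity n).sub (hasSum_radicalDensity n)).tsum_eq,
    card_filter_nonvanishing hn, sub_add_cancel]

end

end AffineSeparable

/-- As `n → ∞`, the proportion of separable elements of `A(n,q)` converges to
`(1 - 1/q)/(1 + 1/(q-1))`. -/
theorem affine_separable_limit (F : Type) [Field F] [Fintype F] (q : ℕ)
    (hq : q = Fintype.card F) :
    Filter.Tendsto (fun n : ℕ => sA F n) Filter.atTop
      (nhds ((1 - 1 / (q : ℝ)) / (1 + 1 / ((q : ℝ) - 1)))) := by
  have h := AffineSeparable.tendsto_sA (F := F)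
  have hq2 := AffineSeparable.two_le_card F
  rw [Nat.card_eq_fintype_card, ← hq] at h hq2
  have h0 : (q : ℝ) ≠ 0 := by linarith
  have h1 : (q : ℝ) - 1 ≠ 0 := by linarith
  have hlim : (1 - 1 / (q : ℝ)) / (1 + 1 / ((q : ℝ) - 1)) = (1 - (q : ℝ)⁻¹) ^ 2 := by
    rw [one_add_div h1, sub_add_cancel]
    field_simp
  rw [hlim]
  exact h
end

section
/- Let q be a prime power. For every n ≥ 1, the proportion of cyclic elements of GL(n, F_q) equals the proportion of cyclic elements of A(n,q) plus 1/(q(q−1)) times the proportion of cyclic elements of A(n−1,q); that is, c_GL(n,q) = c_A(n,q) + c_A(n−1,q)/(q(q−1)). -/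
open Matrix

/-- `c_A(n,q)`: the proportion of cyclic elements (characteristic polynomial equal to the
minimal polynomial) of the affine group `A(n,q)`. -/
noncomputable def cA (F : Type) [Field F] [Fintype F] (n : ℕ) : ℝ :=
  (Nat.card {x : GL (Fin (n + 1)) F //
      IsAff x ∧ x.val.charpoly = minpoly F x.val} : ℝ) /
    (Nat.card {x : GL (Fin (n + 1)) F // IsAff x} : ℝ)

/-- `c_GL(n,q)`: the proportion of cyclic elements of `GL(n, F_q)`. -/
noncomputable def cGL (F : Type) [Field F] [Fintype F] (n : ℕ) : ℝ :=
  (Nat.card {x : GL (Fin n) F // x.val.charpoly = minpoly F x.val} : ℝ) /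
    (Nat.card (GL (Fin n) F) : ℝ)

section

open Polynomial

variable {F : Type} [Field F]

/-- A square matrix is cyclic if its characteristic polynomial is its minimal polynomial. -/
def IsCyclicMatrix {m : Type*} [Fintype m] [DecidableEq m] (M : Matrix m m F) : Prop :=
  M.charpoly = minpoly F M

/-- The block matrix `[[B, 0], [v, 1]]`. -/
def affBlock {m : Type*} (B : Matrix m m F) (v : m → F) : Matrix (m ⊕ Unit) (m ⊕ Unit) F :=
  fromBlocks B 0 (replicateRow Unit v) 1

section Cyclic

variable {m m' : Type*} [Fintype m] [DecidableEq m] [Fintype m'] [DecidableEq m']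

theorem isCyclicMatrix_reindex (e : m ≃ m') (M : Matrix m m F) :
    IsCyclicMatrix (reindex e e M) ↔ IsCyclicMatrix M := by
  unfold IsCyclicMatrix
  rw [charpoly_reindex, ← minpoly.algEquiv_eq (reindexAlgEquiv F F e) M]
  rfl

theorem isCyclicMatrix_conj (g : GL m F) (M : Matrix m m F) :
    IsCyclicMatrix (g.val * M * g⁻¹.val) ↔ IsCyclicMatrix M := by
  unfold IsCyclicMatrix
  have h : minpoly F (g.val * M * g⁻¹.val) = minpoly F M :=
    minpoly.algEquiv_eq
      (MulSemiringAction.toAlgEquiv F (Matrix m m F) (ConjAct.toConjAct g)) M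
  rw [h, coe_units_inv, ← Matrix.charpoly_units_conj g M]

theorem charpoly_affBlock (B : Matrix m m F) (v : m → F) :
    (affBlock B v).charpoly = B.charpoly * (X - C 1) := by
  rw [affBlock, charpoly_fromBlocks_zero₁₂]
  congr 1
  simp [Matrix.charpoly, charmatrix]

theorem exists_aeval_affBlock (B : Matrix m m F) (v : m → F) (p : F[X]) :
    ∃ u : m → F, aeval (affBlock B v) p =
      fromBlocks (aeval B p) 0 (replicateRow Unit u) (p.eval 1 • 1) := by
  induction p using Polynomial.induction_on' with
  | add p r hp hr =>
    obtain ⟨u, hu⟩ := hp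
    obtain ⟨u', hu'⟩ := hr
    refine ⟨u + u', ?_⟩
    rw [map_add, hu, hu', fromBlocks_add]
    simp [replicateRow_add, add_smul]
  | monomial k a =>
    induction k with
    | zero =>
      refine ⟨0, ?_⟩
      ext (i | i) (j | j) <;> simp [algebraMap_eq_diagonal, one_apply, diagonal_apply]
    | succ k ih =>
      obtain ⟨u, hu⟩ := ih
      have h1 : (monomial (k + 1) a : F[X]) = monomial k a * X := by simp
      refine ⟨u ᵥ* B + a • v, ?_⟩
      rw [h1, map_mul, hu, aeval_X, affBlock, fromBlocks_multiply, map_mul, aeval_X]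
      congr 1
      · simp
      · simp
      · ext i j
        simp [replicateRow, mul_apply, vecMul, dotProduct]
      · simp

theorem aeval_mul_X_sub_affBlock (B : Matrix m m F) (v : m → F) (p : F[X]) :
    aeval (affBlock B v) ((X - C 1) * p) =
      fromBlocks ((B - 1) * aeval B p) 0 (replicateRow Unit (v ᵥ* aeval B p)) 0 := by
  obtain ⟨u, hu⟩ := exists_aeval_affBlock B v p
  have h : affBlock B v - 1 = fromBlocks (B - 1) 0 (replicateRow Unit v) 0 := by
    rw [← fromBlocks_one, affBlock, sub_eq_add_neg, fromBlocks_neg, fromBlocks_add]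
    simp [sub_eq_add_neg]
  rw [map_mul, hu]
  simp only [map_sub, aeval_X, map_one, h, fromBlocks_multiply]
  congr 1
  · simp
  · simp
  · ext i j
    simp [replicateRow, mul_apply, vecMul, dotProduct]
  · simp

theorem isCyclicMatrix_of_affBlock {B : Matrix m m F} {v : m → F}
    (h : IsCyclicMatrix (affBlock B v)) : IsCyclicMatrix B := by
  unfold IsCyclicMatrix at *
  rw [charpoly_affBlock] at h
  have h1 : minpoly F (affBlock B v) ∣ (X - C 1) * minpoly F B := by
    apply minpoly.dvd
    rw [aeval_mul_X_sub_affBlock, minpoly.aeval]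
    ext (i | i) (j | j) <;> simp
  rw [← h, mul_comm] at h1
  have h2 := (mul_dvd_mul_iff_left (X_sub_C_ne_zero (1 : F))).1 h1
  exact eq_of_monic_of_associated B.charpoly_monic (minpoly.monic (Matrix.isIntegral B))
    (associated_of_dvd_dvd h2 (minpoly_dvd_charpoly B))

/-- If `B` is cyclic and no nonzero fixed vector of `B` is orthogonal to `v`, then
`affBlock B v` is cyclic. -/
theorem isCyclicMatrix_affBlock_of_forall {B : Matrix m m F} {v : m → F} (hB : IsCyclicMatrix B)
    (h : ∀ w, B *ᵥ w = w → v ⬝ᵥ w = 0 → w = 0) : IsCyclicMatrix (affBlock B v) := by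
  by_contra hc
  have hint := Matrix.isIntegral (R := F) (affBlock B v)
  have hdvd : B.charpoly ∣ minpoly F (affBlock B v) := by
    rw [hB]
    apply minpoly.dvd
    obtain ⟨u, hu⟩ := exists_aeval_affBlock B v (minpoly F (affBlock B v))
    rw [minpoly.aeval, ← fromBlocks_zero] at hu
    exact (fromBlocks_inj.1 hu).1.symm
  have hdvd' := minpoly_dvd_charpoly (affBlock B v)
  rw [charpoly_affBlock] at hdvd'
  obtain ⟨r, hr⟩ := hdvd
  have hr1 : r ∣ X - C 1 := by
    rw [hr] at hdvd'
    exact (mul_dvd_mul_iff_left B.charpoly_monic.ne_zero).1 hdvd'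
  have hru : IsUnit r := by
    rcases (irreducible_X_sub_C (1 : F)).dvd_iff.1 hr1 with h1 | h1
    · exact h1
    · refine absurd ?_ hc
      unfold IsCyclicMatrix
      refine eq_of_monic_of_associated (charpoly_monic _) (minpoly.monic hint) ?_
      rw [charpoly_affBlock, hr]
      exact Associated.mul_left _ h1
  have hz : aeval (affBlock B v) B.charpoly = 0 := by
    have h1 : minpoly F (affBlock B v) ∣ B.charpoly := by
      rw [hr]
      exact (hru.mul_right_dvd).2 dvd_rfl
    exact minpoly.dvd_iff.1 h1
  obtain ⟨u, hu⟩ := exists_aeval_affBlock B v B.charpoly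
  rw [hz, ← fromBlocks_zero] at hu
  have hroot : B.charpoly.eval 1 = 0 := by
    have := congrFun (congrFun (fromBlocks_inj.1 hu).2.2.2 ()) ()
    simpa using this.symm
  obtain ⟨p, hp⟩ := dvd_iff_isRoot.2 hroot
  have hpm : p ≠ 0 := by
    rintro rfl
    exact B.charpoly_monic.ne_zero (by simpa using hp)
  have hpB : aeval B p ≠ 0 := by
    intro h0
    have h1 : minpoly F B ∣ p := minpoly.dvd _ _ h0
    rw [← hB, hp] at h1
    have h2 := natDegree_le_of_dvd h1 hpm
    rw [natDegree_mul (X_sub_C_ne_zero _) hpm, natDegree_X_sub_C] at h2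
    omega
  have hblock := aeval_mul_X_sub_affBlock B v p
  rw [← hp, hz, ← fromBlocks_zero] at hblock
  obtain ⟨h1, -, h2, -⟩ := fromBlocks_inj.1 hblock
  apply hpB
  ext i j
  have hw := h (aeval B p *ᵥ Pi.single j 1) ?_ ?_
  · simpa using congrFun hw i
  · have : (B - 1) *ᵥ (aeval B p *ᵥ Pi.single j 1) = 0 := by
      rw [mulVec_mulVec, ← h1, zero_mulVec]
    rwa [sub_mulVec, one_mulVec, sub_eq_zero] at this
  · rw [dotProduct_mulVec]
    have := congrFun (congrFun h2 ()) j
    simpa using this.symm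

/-- If the fixed space of `B` is at most one-dimensional and `affBlock B v` is cyclic, then no
nonzero fixed vector of `B` is orthogonal to `v`. -/
theorem eq_zero_of_isCyclicMatrix_affBlock {B : Matrix m m F} {v : m → F}
    (hB : ∀ w y : m → F, B *ᵥ w = w → B *ᵥ y = y → w ≠ 0 → ∃ c : F, y = c • w)
    (h : IsCyclicMatrix (affBlock B v)) (w : m → F) (hw : B *ᵥ w = w) (hv : v ⬝ᵥ w = 0) :
    w = 0 := by
  by_contra hw0
  have hcyc := isCyclicMatrix_of_affBlock h
  have hroot : B.charpoly.eval 1 = 0 := by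
    rw [eval_charpoly]
    apply exists_mulVec_eq_zero_iff.1 ⟨w, hw0, ?_⟩
    simp [sub_mulVec, hw]
  obtain ⟨p, hp⟩ := dvd_iff_isRoot.2 hroot
  have h1 : (B - 1) * aeval B p = 0 := by
    have := B.aeval_self_charpoly
    rw [hp] at this
    simpa using this
  have h2 : v ᵥ* aeval B p = 0 := by
    ext j
    obtain ⟨c, hc⟩ := hB w (aeval B p *ᵥ Pi.single j 1) hw (by
      have : (B - 1) *ᵥ (aeval B p *ᵥ Pi.single j 1) = 0 := by
        rw [mulVec_mulVec, h1, zero_mulVec]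
      rwa [sub_mulVec, one_mulVec, sub_eq_zero] at this) hw0
    have h3 : v ⬝ᵥ (aeval B p *ᵥ Pi.single j 1) = 0 := by
      rw [hc, dotProduct_smul, hv, smul_zero]
    rw [dotProduct_mulVec] at h3
    simpa using h3
  have h3 : aeval (affBlock B v) B.charpoly = 0 := by
    rw [hp, aeval_mul_X_sub_affBlock, h1, h2]
    ext (i | i) (j | j) <;> simp
  have h4 := minpoly.dvd _ _ h3
  rw [← h, charpoly_affBlock] at h4
  have h5 := natDegree_le_of_dvd h4 B.charpoly_monic.ne_zero
  rw [natDegree_mul B.charpoly_monic.ne_zero (X_sub_C_ne_zero _), natDegree_X_sub_C] at h5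
  omega

end Cyclic

theorem exists_GL_mulVec_single {n : ℕ} (w : Fin (n + 1) → F) (hw : w ≠ 0) :
    ∃ g : GL (Fin (n + 1)) F, g.val *ᵥ Pi.single 0 1 = w := by
  obtain ⟨k, hk⟩ := Function.ne_iff.1 hw
  let A : Matrix (Fin (n + 1)) (Fin (n + 1)) F := (1 : Matrix _ _ F).updateCol k w
  let P : Matrix (Fin (n + 1)) (Fin (n + 1)) F := (Equiv.swap 0 k).toPEquiv.toMatrix
  have hA : A.det = w k := by
    rw [← cramer_apply, cramer_one]; simp
  refine ⟨GeneralLinearGroup.mkOfDetNeZero (A * P) ?_, ?_⟩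
  · rw [det_mul, hA]
    refine mul_ne_zero hk ?_
    simp only [P, det_permutation]
    rcases Int.units_eq_one_or (Equiv.Perm.sign (Equiv.swap 0 k)) with h | h <;> simp [h]
  · have : P *ᵥ Pi.single 0 1 = Pi.single k 1 := by
      ext i
      simp [P, PEquiv.toMatrix_apply, Pi.single_apply, Equiv.swap_apply_eq_iff]
    change (A * P) *ᵥ _ = w
    rw [← mulVec_mulVec, this]
    ext i
    simp [A]

section Affine

/-- The index equivalence sending `0` to the last block and `i.succ` to `i` in the first block. -/
def affEquiv (n : ℕ) : Fin (n + 1) ≃ Fin n ⊕ Unit :=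
  (finSuccEquiv n).trans (Equiv.optionEquivSumPUnit _)

@[simp] theorem affEquiv_zero (n : ℕ) : affEquiv n 0 = Sum.inr () := rfl

@[simp] theorem affEquiv_succ {n : ℕ} (i : Fin n) : affEquiv n i.succ = Sum.inl i := by
  simp [affEquiv]

/-- The matrix `[[1, v], [0, B]]`. -/
def affMatrix {n : ℕ} (B : Matrix (Fin n) (Fin n) F) (v : Fin n → F) :
    Matrix (Fin (n + 1)) (Fin (n + 1)) F :=
  reindex (affEquiv n).symm (affEquiv n).symm (affBlock B v)

variable {n : ℕ}

theorem affMatrix_injective {B B' : Matrix (Fin n) (Fin n) F} {v v' : Fin n → F}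
    (h : affMatrix B v = affMatrix B' v') : B = B' ∧ v = v' := by
  have h1 := (reindex (affEquiv n).symm (affEquiv n).symm).injective h
  obtain ⟨h2, -, h3, -⟩ := fromBlocks_inj.1 h1
  exact ⟨h2, replicateRow_injective h3⟩

theorem det_affMatrix (B : Matrix (Fin n) (Fin n) F) (v : Fin n → F) :
    (affMatrix B v).det = B.det := by
  rw [affMatrix, det_reindex_self, affBlock, det_fromBlocks_zero₁₂, det_one, mul_one]

theorem isCyclicMatrix_affMatrix (B : Matrix (Fin n) (Fin n) F) (v : Fin n → F) :
    IsCyclicMatrix (affMatrix B v) ↔ IsCyclicMatrix (affBlock B v) :=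
  isCyclicMatrix_reindex _ _

theorem affMatrix_mulVec (B : Matrix (Fin n) (Fin n) F) (v : Fin n → F) (y : Fin (n + 1) → F) :
    affMatrix B v *ᵥ y =
      Fin.cons (y 0 + v ⬝ᵥ Fin.tail y) (B *ᵥ Fin.tail y) := by
  ext i
  refine Fin.cases ?_ (fun i => ?_) i
  · simp [affMatrix, affBlock, mulVec, dotProduct, Fin.sum_univ_succ, Fin.tail]
  · simp [affMatrix, affBlock, mulVec, dotProduct, Fin.sum_univ_succ, Fin.tail]

theorem exists_eq_affMatrix {M : Matrix (Fin (n + 1)) (Fin (n + 1)) F}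
    (h : M *ᵥ Pi.single 0 1 = Pi.single 0 1) : ∃ B v, M = affMatrix B v := by
  refine ⟨M.submatrix Fin.succ Fin.succ, fun j => M 0 j.succ, ?_⟩
  rw [mulVec_single_one] at h
  ext i j
  have hi := congrFun h i
  rw [col_apply] at hi
  refine Fin.cases ?_ (fun j => ?_) j
  · rw [hi]
    refine Fin.cases ?_ (fun i => ?_) i <;> simp [affMatrix, affBlock]
  · refine Fin.cases ?_ (fun i => ?_) i <;> simp [affMatrix, affBlock]

theorem affMatrix_mulVec_single (B : Matrix (Fin n) (Fin n) F) (v : Fin n → F) :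
    affMatrix B v *ᵥ Pi.single 0 1 = Pi.single 0 1 := by
  rw [affMatrix_mulVec]
  have : Fin.tail (Pi.single 0 1 : Fin (n + 1) → F) = 0 := by ext i; simp [Fin.tail]
  rw [this]
  ext i
  refine Fin.cases ?_ (fun i => ?_) i <;> simp

theorem isAff_iff (x : GL (Fin (n + 1)) F) :
    IsAff x ↔ x.val *ᵥ Pi.single 0 1 = Pi.single 0 1 := by
  rw [mulVec_single_one, funext_iff, Fin.forall_fin_succ, IsAff, Fin.forall_fin_succ]
  simp

/-- The fixed space of a cyclic matrix is at most one-dimensional. -/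
theorem IsCyclicMatrix.exists_smul_eq_of_fixed {M : Matrix (Fin n) (Fin n) F}
    (hM : IsCyclicMatrix M) (w y : Fin n → F) (hw : M *ᵥ w = w) (hy : M *ᵥ y = y) (hw0 : w ≠ 0) :
    ∃ c : F, y = c • w := by
  induction n with
  | zero => exact absurd (Subsingleton.elim _ _) hw0
  | succ n ih =>
    obtain ⟨g, rfl⟩ := exists_GL_mulVec_single w hw0
    have hgi : ∀ z, g⁻¹.val *ᵥ (g.val *ᵥ z) = z := fun z => by
      rw [mulVec_mulVec, Units.inv_mul, one_mulVec]
    have hig : ∀ z, g.val *ᵥ (g⁻¹.val *ᵥ z) = z := fun z => by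
      rw [mulVec_mulVec, Units.mul_inv, one_mulVec]
    have h1 : (g⁻¹.val * M * g⁻¹⁻¹.val) *ᵥ Pi.single 0 1 = Pi.single 0 1 := by
      rw [inv_inv, ← mulVec_mulVec, ← mulVec_mulVec, hw, hgi]
    obtain ⟨B, v, hBv⟩ := exists_eq_affMatrix h1
    have hcyc := (isCyclicMatrix_conj g⁻¹ M).2 hM
    rw [hBv, isCyclicMatrix_affMatrix] at hcyc
    have hz : (g⁻¹.val * M * g⁻¹⁻¹.val) *ᵥ (g⁻¹.val *ᵥ y) = g⁻¹.val *ᵥ y := by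
      rw [inv_inv, ← mulVec_mulVec, ← mulVec_mulVec, hig, hy]
    set z := g⁻¹.val *ᵥ y with hzdef
    rw [hBv, affMatrix_mulVec] at hz
    have htail : Fin.tail z = 0 := by
      apply eq_zero_of_isCyclicMatrix_affBlock (fun w y h1 h2 h3 =>
        ih (isCyclicMatrix_of_affBlock hcyc) w y h1 h2 h3) hcyc
      · have := congrArg Fin.tail hz
        rwa [Fin.tail_cons] at this
      · have := congrFun hz 0
        simpa using this
    refine ⟨z 0, ?_⟩
    have h2 : z = z 0 • Pi.single 0 1 := by
      ext i
      refine Fin.cases ?_ (fun i => ?_) i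
      · simp
      · simpa [Fin.tail] using congrFun htail i
    rw [← mulVec_smul, ← h2, hzdef, hig]

theorem isCyclicMatrix_affMatrix_iff (B : Matrix (Fin n) (Fin n) F) (v : Fin n → F) :
    IsCyclicMatrix (affMatrix B v) ↔
      IsCyclicMatrix B ∧ ∀ w, B *ᵥ w = w → v ⬝ᵥ w = 0 → w = 0 := by
  rw [isCyclicMatrix_affMatrix]
  refine ⟨fun h => ⟨isCyclicMatrix_of_affBlock h, ?_⟩,
    fun h => isCyclicMatrix_affBlock_of_forall h.1 h.2⟩
  exact eq_zero_of_isCyclicMatrix_affBlock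
    (isCyclicMatrix_of_affBlock h).exists_smul_eq_of_fixed h

/-- `A(n,q)` as pairs of an invertible matrix and a row vector. -/
noncomputable def affGL (p : GL (Fin n) F × (Fin n → F)) :
    {x : GL (Fin (n + 1)) F // IsAff x} :=
  ⟨GeneralLinearGroup.mkOfDetNeZero (affMatrix p.1.val p.2) (by
    rw [det_affMatrix]; exact p.1.det.ne_zero), by
    rw [isAff_iff]; exact affMatrix_mulVec_single _ _⟩

theorem affGL_bijective : Function.Bijective (affGL (F := F) (n := n)) := by
  constructor
  · rintro ⟨B, v⟩ ⟨B', v'⟩ h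
    have h1 := congrArg (fun x => x.1.val) h
    obtain ⟨h2, h3⟩ := affMatrix_injective h1
    exact Prod.ext (Units.ext h2) h3
  · rintro ⟨x, hx⟩
    obtain ⟨B, v, h⟩ := exists_eq_affMatrix ((isAff_iff x).1 hx)
    have hdet : B.det ≠ 0 := by
      rw [← det_affMatrix B v, ← h]; exact x.det.ne_zero
    exact ⟨(GeneralLinearGroup.mkOfDetNeZero B hdet, v), Subtype.ext (Units.ext h.symm)⟩

end Affine

section Counting

theorem card_isAff_isCyclicMatrix (n : ℕ) :
    Nat.card {x : GL (Fin (n + 1)) F // IsAff x ∧ IsCyclicMatrix x.val} =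
      Nat.card ((B : {B : GL (Fin n) F // IsCyclicMatrix B.val}) ×
        {v : Fin n → F // ∀ w, B.1.val *ᵥ w = w → v ⬝ᵥ w = 0 → w = 0}) := by
  refine Nat.card_congr ?_
  refine (Equiv.subtypeSubtypeEquivSubtypeInter _ _).symm.trans ?_
  refine ((Equiv.ofBijective _ affGL_bijective).subtypeEquiv
    (p := fun p => IsCyclicMatrix p.1.val ∧ ∀ w, p.1.val *ᵥ w = w → p.2 ⬝ᵥ w = 0 → w = 0)
    fun p => (isCyclicMatrix_affMatrix_iff _ _).symm).symm.trans ?_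
  exact
    { toFun := fun p => ⟨⟨p.1.1, p.2.1⟩, ⟨p.1.2, p.2.2⟩⟩
      invFun := fun p => ⟨(p.1.1, p.2.1), ⟨p.1.2, p.2.2⟩⟩
      left_inv := fun _ => rfl
      right_inv := fun _ => rfl }

theorem card_fixed_pairs (n : ℕ) :
    Nat.card ((B : {B : GL (Fin (n + 1)) F // IsCyclicMatrix B.val}) ×
        {w : {w : Fin (n + 1) → F // w ≠ 0} // B.1.val *ᵥ w.1 = w.1}) =
      Nat.card {w : Fin (n + 1) → F // w ≠ 0} *
        Nat.card {x : GL (Fin (n + 1)) F // IsAff x ∧ IsCyclicMatrix x.val} := by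
  rw [← Nat.card_prod]
  choose g hg using fun w : {w : Fin (n + 1) → F // w ≠ 0} => exists_GL_mulVec_single w.1 w.2
  have hgi : ∀ w, (g w)⁻¹.val *ᵥ w.1 = Pi.single 0 1 := fun w => by
    rw [← hg w, mulVec_mulVec, Units.inv_mul, one_mulVec]
  refine Nat.card_congr
    { toFun := fun p => (p.2.1, ⟨(g p.2.1)⁻¹ * p.1.1 * (g p.2.1)⁻¹⁻¹, ?_, ?_⟩)
      invFun := fun p => ⟨⟨g p.1 * p.2.1 * (g p.1)⁻¹, ?_⟩, ⟨p.1, ?_⟩⟩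
      left_inv := fun p => ?_
      right_inv := fun p => ?_ }
  · rw [isAff_iff]
    simp only [inv_inv, Units.val_mul, ← mulVec_mulVec]
    rw [hg, p.2.2, hgi]
  · exact (isCyclicMatrix_conj _ _).2 p.1.2
  · exact (isCyclicMatrix_conj _ _).2 p.2.2.2
  · simp only [Units.val_mul, ← mulVec_mulVec]
    rw [hgi, (isAff_iff _).1 p.2.2.1, hg]
  · obtain ⟨⟨B, hB⟩, w, hw⟩ := p
    refine Sigma.subtype_ext (Subtype.ext ?_) rfl
    simp [mul_assoc]
  · obtain ⟨w, x, hx⟩ := p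
    simp [mul_assoc]

theorem card_vec (K : Type) [Finite K] (n : ℕ) : Nat.card (Fin n → K) = Nat.card K ^ n := by
  simp [Nat.card_fun]

variable [Fintype F]

theorem card_isAff (n : ℕ) :
    Nat.card {x : GL (Fin (n + 1)) F // IsAff x} = Nat.card (GL (Fin n) F) * Nat.card F ^ n := by
  rw [← Nat.card_congr (Equiv.ofBijective _ affGL_bijective), Nat.card_prod, card_vec]

theorem card_dotProduct_eq_zero {n : ℕ} {w : Fin n → F} (hw : w ≠ 0) :
    Nat.card F * Nat.card {v : Fin n → F // v ⬝ᵥ w = 0} = Nat.card F ^ n := by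
  let f : (Fin n → F) →+ F :=
    { toFun := fun v => v ⬝ᵥ w
      map_zero' := zero_dotProduct w
      map_add' := fun a b => add_dotProduct a b w }
  have hf : Function.Surjective f := by
    obtain ⟨k, hk⟩ := Function.ne_iff.1 hw
    intro c
    refine ⟨Pi.single k (c / w k), ?_⟩
    change Pi.single k (c / w k) ⬝ᵥ w = c
    rw [single_dotProduct]
    exact div_mul_cancel₀ c hk
  have h := AddSubgroup.card_eq_card_quotient_mul_card_addSubgroup f.ker
  rw [Nat.card_congr (QuotientAddGroup.quotientKerEquivOfSurjective f hf).toEquiv, card_vec] at h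
  exact h.symm

theorem card_orthogonal_and_card_fixed {n : ℕ} {B : Matrix (Fin n) (Fin n) F}
    (hB : IsCyclicMatrix B) :
    (Nat.card F : ℝ) * (Nat.card F - 1) *
        Nat.card {v : Fin n → F // ∀ w, B *ᵥ w = w → v ⬝ᵥ w = 0 → w = 0} =
      Nat.card F * (Nat.card F - 1) * Nat.card F ^ n -
        Nat.card F ^ n * Nat.card {w : {w : Fin n → F // w ≠ 0} // B *ᵥ w.1 = w.1} := by
  by_cases h : ∃ w₀, w₀ ≠ 0 ∧ B *ᵥ w₀ = w₀
  · obtain ⟨w₀, h0, hw₀⟩ := h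
    have h1 : Nat.card {w : {w : Fin n → F // w ≠ 0} // B *ᵥ w.1 = w.1} + 1 = Nat.card F := by
      have hfix : ∀ c : F, B *ᵥ (c • w₀) = c • w₀ := fun c => by rw [mulVec_smul, hw₀]
      let f : Fˣ → {w : {w : Fin n → F // w ≠ 0} // B *ᵥ w.1 = w.1} := fun c =>
        ⟨⟨c.1 • w₀, smul_ne_zero c.ne_zero h0⟩, hfix c.1⟩
      have hf : Function.Bijective f := by
        refine ⟨fun c d hcd => Units.ext (smul_left_injective F h0 ?_), fun ⟨⟨w, hw⟩, hBw⟩ => ?_⟩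
        · exact congrArg (fun w => w.1.1) hcd
        · obtain ⟨c, rfl⟩ := hB.exists_smul_eq_of_fixed w₀ w hw₀ hBw h0
          exact ⟨Units.mk0 c (left_ne_zero_of_smul hw), rfl⟩
      rw [← Nat.card_congr (Equiv.ofBijective f hf), Nat.card_units,
        Nat.sub_add_cancel Nat.card_pos]
    have h2 : ∀ v : Fin n → F, (∀ w, B *ᵥ w = w → v ⬝ᵥ w = 0 → w = 0) ↔ ¬ v ⬝ᵥ w₀ = 0 := by
      intro v
      refine ⟨fun h hv => h0 (h w₀ hw₀ hv), fun hv w hw hvw => ?_⟩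
      obtain ⟨c, rfl⟩ := hB.exists_smul_eq_of_fixed w₀ w hw₀ hw h0
      rw [dotProduct_smul, smul_eq_mul] at hvw
      rw [(mul_eq_zero.1 hvw).resolve_right hv, zero_smul]
    have h3 := card_dotProduct_eq_zero h0
    have h4 : Nat.card {v : Fin n → F // v ⬝ᵥ w₀ = 0} +
        Nat.card {v : Fin n → F // ¬ v ⬝ᵥ w₀ = 0} = Nat.card F ^ n := by
      classical
      rw [← Nat.card_sum, Nat.card_congr (Equiv.sumCompl _), card_vec]
    rw [Nat.card_congr (Equiv.subtypeEquivRight h2)]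
    have h1' : (Nat.card {w : {w : Fin n → F // w ≠ 0} // B *ᵥ w.1 = w.1} : ℝ) =
        Nat.card F - 1 := by
      rw [← h1]; push_cast; ring
    have h3' : (Nat.card F : ℝ) * Nat.card {v : Fin n → F // v ⬝ᵥ w₀ = 0} =
        Nat.card F ^ n := by exact_mod_cast h3
    have h4' : (Nat.card {v : Fin n → F // v ⬝ᵥ w₀ = 0} : ℝ) +
        Nat.card {v : Fin n → F // ¬ v ⬝ᵥ w₀ = 0} = Nat.card F ^ n := by exact_mod_cast h4
    rw [h1']
    linear_combination (Nat.card F : ℝ) * (Nat.card F - 1) * h4' - ((Nat.card F : ℝ) - 1) * h3'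
  · push Not at h
    have h1 : Nat.card {w : {w : Fin n → F // w ≠ 0} // B *ᵥ w.1 = w.1} = 0 := by
      have : IsEmpty {w : {w : Fin n → F // w ≠ 0} // B *ᵥ w.1 = w.1} :=
        ⟨fun w => h w.1.1 w.1.2 w.2⟩
      exact Nat.card_of_isEmpty
    have h2 : Nat.card {v : Fin n → F // ∀ w, B *ᵥ w = w → v ⬝ᵥ w = 0 → w = 0} =
        Nat.card F ^ n := by
      rw [← card_vec]
      refine Nat.card_congr (Equiv.subtypeUnivEquiv fun v w hw _ => ?_)
      by_contra hw0
      exact h w hw0 hw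
    rw [h1, h2]
    push_cast
    ring

theorem card_ne_zero_add_one (n : ℕ) : Nat.card {w : Fin n → F // w ≠ 0} + 1 = Nat.card F ^ n := by
  classical
  rw [← card_vec, ← Nat.card_congr (Equiv.sumCompl (fun w : Fin n → F => w = 0)), Nat.card_sum,
    add_comm]
  simp

theorem card_GL_succ (n : ℕ) :
    Nat.card (GL (Fin (n + 1)) F) =
      (Nat.card F ^ (n + 1) - 1) * (Nat.card (GL (Fin n) F) * Nat.card F ^ n) := by
  rw [card_GL_field, card_GL_field, Fin.prod_univ_succ]
  simp only [Fin.val_zero, pow_zero, Fin.val_succ, Nat.card_eq_fintype_card]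
  congr 1
  have : ∀ i : Fin n, Fintype.card F ^ (n + 1) - Fintype.card F ^ (i.1 + 1) =
      (Fintype.card F ^ n - Fintype.card F ^ i.1) * Fintype.card F := fun i => by
    rw [Nat.sub_mul, pow_succ, pow_succ]
  simp [this, Finset.prod_mul_distrib]

theorem card_isCyclicMatrix_relation (n : ℕ) :
    (Nat.card F : ℝ) * (Nat.card F - 1) *
        Nat.card {x : GL (Fin (n + 2)) F // IsAff x ∧ IsCyclicMatrix x.val} =
      Nat.card F * (Nat.card F - 1) * Nat.card F ^ (n + 1) *
        Nat.card {B : GL (Fin (n + 1)) F // IsCyclicMatrix B.val} -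
        Nat.card F ^ (n + 1) * ((Nat.card F ^ (n + 1) - 1) *
          Nat.card {x : GL (Fin (n + 1)) F // IsAff x ∧ IsCyclicMatrix x.val}) := by
  classical
  have h1 : (Nat.card {w : Fin (n + 1) → F // w ≠ 0} : ℝ) = Nat.card F ^ (n + 1) - 1 := by
    rw [eq_sub_iff_add_eq]
    exact_mod_cast card_ne_zero_add_one (n + 1)
  rw [card_isAff_isCyclicMatrix (n + 1), ← h1, ← Nat.cast_mul, ← card_fixed_pairs,
    Nat.card_sigma, Nat.card_sigma]
  push_cast
  rw [Finset.mul_sum, Finset.mul_sum,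
    Finset.sum_congr rfl fun B _ => card_orthogonal_and_card_fixed B.2, Finset.sum_sub_distrib]
  simp [mul_comm]

end Counting

end

/-- For `n ≥ 1`, `c_GL(n,q) = c_A(n,q) + c_A(n-1,q)/(q(q-1))`. -/
theorem cyclic_GL_affine_relation (F : Type) [Field F] [Fintype F] (q : ℕ)
    (hq : q = Fintype.card F) (n : ℕ) (hn : 1 ≤ n) :
    cGL F n = cA F n + cA F (n - 1) / ((q : ℝ) * ((q : ℝ) - 1)) := by
  obtain ⟨n, rfl⟩ : ∃ k, n = k + 1 := ⟨n - 1, by omega⟩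
  rw [← Nat.card_eq_fintype_card] at hq
  have hrel := card_isCyclicMatrix_relation (F := F) n
  have hA := card_isAff (F := F) (n + 1)
  have hA' := card_isAff (F := F) n
  have hG := card_GL_succ (F := F) n
  rw [← hA', ← hq] at hG
  rw [← hq] at hrel hA
  have hq1 : 1 < q := by rw [hq]; exact Finite.one_lt_card
  have hq1' : (1 : ℝ) < q := by exact_mod_cast hq1
  have hp : (1 : ℝ) < (q : ℝ) ^ (n + 1) := one_lt_pow₀ hq1' (by omega)
  have hG' : (Nat.card (GL (Fin (n + 1)) F) : ℝ) =
      ((q : ℝ) ^ (n + 1) - 1) * Nat.card {x : GL (Fin (n + 1)) F // IsAff x} := by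
    rw [hG, Nat.cast_mul, Nat.cast_sub (Nat.one_le_pow _ _ (by omega))]
    push_cast
    rfl
  have hG0 : (Nat.card (GL (Fin (n + 1)) F) : ℝ) ≠ 0 := by
    exact_mod_cast Nat.card_pos.ne'
  have hA0 : (Nat.card {x : GL (Fin (n + 1)) F // IsAff x} : ℝ) ≠ 0 := by
    intro h
    rw [h, mul_zero] at hG'
    exact hG0 hG'
  unfold IsCyclicMatrix at hrel
  unfold cGL cA
  rw [Nat.add_sub_cancel, hA]
  push_cast
  rw [hG']
  have h1 : (q : ℝ) - 1 ≠ 0 := by linarith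
  have h2 : (q : ℝ) ^ (n + 1) - 1 ≠ 0 := by linarith
  have h3 : (q : ℝ) ≠ 0 := by linarith
  generalize (Nat.card {x : GL (Fin (n + 1 + 1)) F //
      IsAff x ∧ x.val.charpoly = minpoly F x.val} : ℝ) = a at *
  generalize (Nat.card {x : GL (Fin (n + 1)) F // x.val.charpoly = minpoly F x.val} : ℝ) = c at *
  generalize (Nat.card {x : GL (Fin (n + 1)) F //
      IsAff x ∧ x.val.charpoly = minpoly F x.val} : ℝ) = b at *
  generalize (Nat.card {x : GL (Fin (n + 1)) F // IsAff x} : ℝ) = d at *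
  have h4 : (q : ℝ) ^ (n + 1) ≠ 0 := by positivity
  generalize (q : ℝ) ^ (n + 1) = r at *
  field_simp
  linear_combination -hrel
end
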